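/- arXiv:2006.01718 — 11 statements merged into one kernel-verified Lean document; each statement's English description precedes it below -/
import Mathlib

section
/- Suppose both (IQP) and (QP) have optimal solutions, and let x^d be an optimal solution to (IQP). Then for every ε ∈ (0,1] there exists an ε-approximate solution x^⋆ to (QP) such that ‖x^⋆ − x^d‖_∞ ≤ n·Δ·(10Δ/ε + 1)^k. -/
open scoped BigOperators

/-- The polyhedron `P = {x ∈ ℝⁿ : Ax ≤ b}`. -/
def polyP {m n : ℕ} (A : Matrix (Fin m) (Fin n) ℤ) (b : Fin m → ℝ) : Set (Fin n → ℝ) :=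
  {x | ∀ i, ∑ j, (A i j : ℝ) * x j ≤ b i}

/-- The integer points of `ℝⁿ`. -/
def intPts (n : ℕ) : Set (Fin n → ℝ) := {x | ∀ i, ∃ z : ℤ, x i = (z : ℝ)}

/-- `x` is an optimal solution of `min {f x : x ∈ S}`. -/
def IsOptimalSol {α : Type*} (f : α → ℝ) (S : Set α) (x : α) : Prop :=
  x ∈ S ∧ ∀ y ∈ S, f x ≤ f y

/-- `x` is an ε-approximate solution of `min {f x : x ∈ S}` with optimal solution `xopt`:
`f(x) - f(xopt) ≤ ε (f_max - f(xopt))`, computed in `EReal` so that `f_max = +∞` is allowed. -/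
def IsEpsApprox {α : Type*} (f : α → ℝ) (S : Set α) (xopt : α) (ε : ℝ) (x : α) : Prop :=
  x ∈ S ∧
    ((f x : EReal) - (f xopt : EReal) ≤
      (ε : EReal) * ((⨆ y ∈ S, (f y : EReal)) - (f xopt : EReal)))

/-- `Δ` is the maximum of the absolute values of the determinants of the nonempty
square submatrices of `A`. -/
def MaxSubdet {m n : ℕ} (A : Matrix (Fin m) (Fin n) ℤ) (Δ : ℤ) : Prop :=
  (∀ (r : ℕ) (fr : Fin r → Fin m) (fc : Fin r → Fin n), 0 < r →
      Function.Injective fr → Function.Injective fc → |(A.submatrix fr fc).det| ≤ Δ) ∧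
  (∃ (r : ℕ) (fr : Fin r → Fin m) (fc : Fin r → Fin n), 0 < r ∧
      Function.Injective fr ∧ Function.Injective fc ∧ |(A.submatrix fr fc).det| = Δ)

/-- A vector with at most one nonzero entry, of absolute value at most one. -/
def IsUnitLike {r : ℕ} (x : Fin r → ℤ) : Prop :=
  ∃ l, |x l| ≤ 1 ∧ ∀ l', l' ≠ l → x l' = 0

lemma IsUnitLike.comp_injective {r s : ℕ} {x : Fin r → ℤ} (hx : IsUnitLike x)
    {g : Fin s → Fin r} (hg : Function.Injective g) (i : Fin s) : IsUnitLike (x ∘ g) := by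
  obtain ⟨l, hl, h0⟩ := hx
  by_cases hex : ∃ t, g t = l
  · obtain ⟨t, rfl⟩ := hex
    exact ⟨t, hl, fun t' ht' => h0 _ (hg.ne ht')⟩
  · push Not at hex
    exact ⟨i, by simp [h0 _ (hex i)], fun t' _ => h0 _ (hex t')⟩

lemma abs_det_le_of_rows {m n : ℕ} {A : Matrix (Fin m) (Fin n) ℤ} {Δ : ℤ}
    (hΔ : MaxSubdet A Δ) (hΔ1 : 1 ≤ Δ) (r : ℕ) :
    ∀ (N : Matrix (Fin r) (Fin r) ℤ) (fc : Fin r → Fin n), Function.Injective fc →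
      (∀ i, (∃ a, ∀ l, N i l = A a (fc l)) ∨ IsUnitLike (N i)) → |N.det| ≤ Δ := by
  induction r with
  | zero => intro N fc _ _; simpa using hΔ1
  | succ r ih =>
    intro N fc hfc hN
    by_cases hunit : ∃ i, IsUnitLike (N i)
    · obtain ⟨i, l, hl, h0⟩ := hunit
      rw [Matrix.det_succ_row N i, Finset.sum_eq_single l
        (fun l' _ hl' => by rw [h0 l' hl']; simp) (by simp)]
      have hminor : |(N.submatrix i.succAbove l.succAbove).det| ≤ Δ := by
        refine ih _ (fc ∘ l.succAbove) (hfc.comp Fin.succAbove_right_injective) fun t => ?_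
        rcases hN (i.succAbove t) with ⟨a, ha⟩ | hu
        · exact Or.inl ⟨a, fun s => ha _⟩
        · exact Or.inr (hu.comp_injective Fin.succAbove_right_injective t)
      rw [abs_mul, abs_mul, abs_pow, abs_neg, abs_one, one_pow, one_mul]
      calc _ ≤ 1 * |(N.submatrix i.succAbove l.succAbove).det| :=
            mul_le_mul_of_nonneg_right hl (abs_nonneg _)
        _ ≤ Δ := by rwa [one_mul]
    · have hrow : ∀ i, ∃ a, ∀ l, N i l = A a (fc l) := fun i =>
        (hN i).resolve_right fun hu => hunit ⟨i, hu⟩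
      choose fr hfr using hrow
      by_cases hinj : Function.Injective fr
      · have : N = A.submatrix fr fc := by ext i l; exact hfr i l
        rw [this]
        exact hΔ.1 _ fr fc (Nat.succ_pos r) hinj hfc
      · obtain ⟨i, i', hii, hne⟩ : ∃ i i', fr i = fr i' ∧ i ≠ i' := by
          simpa [Function.Injective] using hinj
        rw [Matrix.det_zero_of_row_eq hne (by ext l; rw [hfr, hfr, hii])]
        simpa using hΔ1.trans' zero_le_one

/-- Every coordinate of `D x` has the sign of the corresponding coordinate of `D u`, or is zero. -/
def SignConformal {ι : Type*} {n : ℕ} (D : Matrix ι (Fin n) ℝ) (x u : Fin n → ℝ) : Prop :=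
  ∀ i, (0 ≤ D.mulVec u i → 0 ≤ D.mulVec x i) ∧ (D.mulVec u i ≤ 0 → D.mulVec x i ≤ 0)

section SignConformal

variable {ι : Type*} {n : ℕ} {D : Matrix ι (Fin n) ℝ} {x y u : Fin n → ℝ}

lemma SignConformal.refl (D : Matrix ι (Fin n) ℝ) (u : Fin n → ℝ) : SignConformal D u u :=
  fun _ => ⟨id, id⟩

lemma SignConformal.trans (hxy : SignConformal D x y) (hyu : SignConformal D y u) :
    SignConformal D x u :=
  fun i => ⟨fun h => (hxy i).1 ((hyu i).1 h), fun h => (hxy i).2 ((hyu i).2 h)⟩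

lemma SignConformal.eq_zero (hxu : SignConformal D x u) {i : ι} (hi : D.mulVec u i = 0) :
    D.mulVec x i = 0 :=
  le_antisymm ((hxu i).2 hi.le) ((hxu i).1 hi.ge)

lemma SignConformal.smul (hxu : SignConformal D x u) {c : ℝ} (hc : 0 ≤ c) :
    SignConformal D (c • x) u := by
  intro i
  simp only [Matrix.mulVec_smul, Pi.smul_apply, smul_eq_mul]
  exact ⟨fun h => mul_nonneg hc ((hxu i).1 h),
    fun h => mul_nonpos_of_nonneg_of_nonpos hc ((hxu i).2 h)⟩

lemma SignConformal.sum {κ : Type*} (s : Finset κ) {v : κ → Fin n → ℝ}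
    (hv : ∀ j ∈ s, SignConformal D (v j) u) : SignConformal D (∑ j ∈ s, v j) u := by
  intro i
  rw [Matrix.mulVec_sum, Finset.sum_apply]
  exact ⟨fun h => Finset.sum_nonneg fun j hj => (hv j hj i).1 h,
    fun h => Finset.sum_nonpos fun j hj => (hv j hj i).2 h⟩

/-- Moving from `w` against a direction `x` that vanishes wherever `w` does, until a new
coordinate of `D w` vanishes. -/
lemma exists_conformal_sub_smul [Finite ι] {w : Fin n → ℝ}
    (hx0 : ∀ i, D.mulVec w i = 0 → D.mulVec x i = 0)
    (hpos : ∃ i, 0 < D.mulVec x i * D.mulVec w i) :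
    ∃ t : ℝ, 0 < t ∧ SignConformal D (w - t • x) w ∧
      ∃ i, D.mulVec w i ≠ 0 ∧ D.mulVec (w - t • x) i = 0 := by
  obtain ⟨i, hi, hmin⟩ := Set.exists_min_image {i | 0 < D.mulVec x i * D.mulVec w i}
    (fun i => D.mulVec w i / D.mulVec x i) (Set.toFinite _) hpos
  have hi' : 0 < D.mulVec x i * D.mulVec w i := hi
  have hxi : D.mulVec x i ≠ 0 := left_ne_zero_of_mul hi'.ne'
  have hwi : D.mulVec w i ≠ 0 := right_ne_zero_of_mul hi'.ne'
  have ht : 0 < D.mulVec w i / D.mulVec x i := by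
    rw [div_pos_iff]; rcases mul_pos_iff.1 hi' with h | h <;> tauto
  refine ⟨D.mulVec w i / D.mulVec x i, ht, fun l => ?_, i, hwi, ?_⟩
  · set t := D.mulVec w i / D.mulVec x i
    simp only [Matrix.mulVec_sub, Matrix.mulVec_smul, Pi.sub_apply, Pi.smul_apply, smul_eq_mul]
    by_cases hl : 0 < D.mulVec x l * D.mulVec w l
    · have hle : t ≤ D.mulVec w l / D.mulVec x l := hmin l hl
      rcases mul_pos_iff.1 hl with ⟨h1, h2⟩ | ⟨h1, h2⟩
      · rw [le_div_iff₀ h1] at hle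
        exact ⟨fun _ => by linarith, fun h => by linarith⟩
      · rw [le_div_iff_of_neg h1] at hle
        exact ⟨fun _ => by linarith, fun h => by linarith⟩
    · rcases lt_trichotomy (D.mulVec w l) 0 with h | h | h
      · have : 0 ≤ D.mulVec x l := by by_contra hc; exact hl (by nlinarith)
        exact ⟨fun _ => by linarith, fun _ => by nlinarith⟩
      · simp [h, hx0 l h]
      · have : D.mulVec x l ≤ 0 := by by_contra hc; exact hl (by nlinarith)
        exact ⟨fun _ => by nlinarith, fun _ => by linarith⟩
  · simp only [Matrix.mulVec_sub, Matrix.mulVec_smul, Pi.sub_apply, Pi.smul_apply, smul_eq_mul]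
    field_simp
    ring

/-- Every nonzero `u` dominates a nonzero `w` that is determined up to scaling by
the vanishing coordinates of `D w`. -/
lemma exists_conformal_elementary [Finite ι] (hD : ∀ x, D.mulVec x = 0 → x = 0) (hu : u ≠ 0) :
    ∃ w, w ≠ 0 ∧ SignConformal D w u ∧
      ∀ x, (∀ i, D.mulVec w i = 0 → D.mulVec x i = 0) → ∃ c : ℝ, x = c • w := by
  obtain ⟨w, ⟨hw0, hwu⟩, hmin⟩ := (measure fun w => {i | D.mulVec w i ≠ 0}.ncard).wf.has_min
    {w | w ≠ 0 ∧ SignConformal D w u} ⟨u, hu, SignConformal.refl D u⟩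
  have key : ∀ x, (∀ i, D.mulVec w i = 0 → D.mulVec x i = 0) →
      (∃ i, 0 < D.mulVec x i * D.mulVec w i) → ∃ c : ℝ, x = c • w := by
    intro x hx hpos
    obtain ⟨t, ht, hconf, i, hi, hi0⟩ := exists_conformal_sub_smul hx hpos
    have hz : w - t • x = 0 := by
      by_contra hne
      refine hmin _ ⟨hne, hconf.trans hwu⟩ ?_
      refine Set.ncard_lt_ncard ?_ (Set.toFinite _)
      refine ⟨fun l hl hl0 => hl (hconf.eq_zero hl0), fun hsub => ?_⟩
      exact hsub hi hi0
    refine ⟨t⁻¹, ?_⟩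
    rw [sub_eq_zero.1 hz, smul_smul, inv_mul_cancel₀ ht.ne', one_smul]
  refine ⟨w, hw0, hwu, fun x hx => ?_⟩
  by_cases hx0 : x = 0
  · exact ⟨0, by simp [hx0]⟩
  obtain ⟨i, hi⟩ : ∃ i, D.mulVec x i ≠ 0 := by
    by_contra! hc
    exact hx0 (hD x (funext hc))
  have hwi : D.mulVec w i ≠ 0 := fun h => hi (hx i h)
  rcases lt_or_gt_of_ne (mul_ne_zero hi hwi) with hneg | hpos
  · obtain ⟨c, hc⟩ := key (-x) (fun l hl => by simp [Matrix.mulVec_neg, hx l hl])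
      ⟨i, by simpa [Matrix.mulVec_neg] using hneg⟩
    exact ⟨-c, by rw [neg_smul, ← hc, neg_neg]⟩
  · exact key x hx ⟨i, hpos⟩

end SignConformal

/-- The real matrix whose rows are the rows of `A` followed by the unit vectors. -/
noncomputable def extRows {m n : ℕ} (A : Matrix (Fin m) (Fin n) ℤ) :
    Matrix (Fin m ⊕ Fin n) (Fin n) ℝ :=
  (Matrix.fromRows A 1).map (Int.cast : ℤ → ℝ)

section ExtRows

variable {m n : ℕ} {A : Matrix (Fin m) (Fin n) ℤ}

lemma extRows_mulVec_inl (x : Fin n → ℝ) (i : Fin m) :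
    (extRows A).mulVec x (Sum.inl i) = ∑ j, (A i j : ℝ) * x j := by
  simp [extRows, Matrix.mulVec, dotProduct]

lemma extRows_mulVec_inr (x : Fin n → ℝ) (j : Fin n) :
    (extRows A).mulVec x (Sum.inr j) = x j := by
  simp [extRows, Matrix.mulVec, dotProduct, Matrix.one_apply]

lemma eq_zero_of_extRows_mulVec {x : Fin n → ℝ} (hx : (extRows A).mulVec x = 0) : x = 0 := by
  ext j
  rw [← extRows_mulVec_inr (A := A) x j, hx]
  rfl

/-- If only zero is orthogonal to all vectors of a set, then the set contains a basis, which
we arrange as the rows of an invertible matrix. -/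
lemma exists_matrix_rows_mem {n : ℕ} (s : Set (Fin n → ℝ))
    (hs : ∀ x : Fin n → ℝ, (∀ y ∈ s, y ⬝ᵥ x = 0) → x = 0) :
    ∃ M : Matrix (Fin n) (Fin n) ℝ, (∀ i, M i ∈ s) ∧ IsUnit M := by
  have hspan : ⊤ ≤ Submodule.span ℝ s := by
    by_contra hne
    obtain ⟨g, hg0, hg⟩ := Submodule.exists_le_ker_of_lt_top _
      (lt_top_iff_ne_top.2 fun h => hne h.ge)
    have hgx : ∀ y, g y = y ⬝ᵥ fun j => g (Pi.single j 1) := by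
      intro y
      conv_lhs => rw [pi_eq_sum_univ' y]
      simp [dotProduct, map_sum]
    have hz := hs (fun j => g (Pi.single j 1)) fun y hy => by
      rw [← hgx]
      exact hg (Submodule.subset_span hy)
    exact hg0 (LinearMap.ext fun y => by rw [hgx, hz]; simp)
  let B := Module.Basis.ofSpan hspan
  have := Module.Finite.finite_basis B
  have := Fintype.ofFinite ((linearIndepOn_empty ℝ id).extend (Set.empty_subset s))
  let B' := B.reindex (Fintype.equivFinOfCardEq
    (by rw [← Module.finrank_eq_card_basis B, Module.finrank_fin_fun]))
  refine ⟨Matrix.of fun i => B' i, fun i => ?_, ?_⟩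
  · exact Module.Basis.ofSpan_subset hspan ⟨_, (B.reindex_apply _ i).symm⟩
  · exact Matrix.linearIndependent_rows_iff_isUnit.1 B'.linearIndependent

/-- Every nonzero vector dominates a nonzero integer vector with entries bounded by the
subdeterminants. -/
lemma exists_int_signConformal {Δ : ℤ} (hΔ : MaxSubdet A Δ) (hΔ1 : 1 ≤ Δ)
    {u : Fin n → ℝ} (hu : u ≠ 0) :
    ∃ v : Fin n → ℤ, v ≠ 0 ∧ (∀ j, |v j| ≤ Δ) ∧
      SignConformal (extRows A) (fun j => (v j : ℝ)) u := by
  obtain ⟨w, hw0, hwu, hspan⟩ :=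
    exists_conformal_elementary (D := extRows A) (fun _ => eq_zero_of_extRows_mulVec) hu
  obtain ⟨j₀, hj₀⟩ : ∃ j, w j ≠ 0 := by
    by_contra! hc
    exact hw0 (funext hc)
  let E := Matrix.fromRows A (1 : Matrix (Fin n) (Fin n) ℤ)
  obtain ⟨M, hM, hMu⟩ := exists_matrix_rows_mem
    {y | ∃ i, y = extRows A i ∧ ((extRows A).mulVec w i = 0 ∨ i = Sum.inr j₀)} (by
      intro x hx
      obtain ⟨c, rfl⟩ := hspan x fun i hi => hx _ ⟨i, rfl, Or.inl hi⟩
      have h0 : (extRows A).mulVec (c • w) (Sum.inr j₀) = 0 := hx _ ⟨_, rfl, Or.inr rfl⟩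
      rw [extRows_mulVec_inr] at h0
      have hc : c = 0 := by simpa [hj₀] using h0
      simp [hc])
  choose row hrow hrow' using hM
  let N : Matrix (Fin n) (Fin n) ℤ := E.submatrix row id
  have hNM : N.map (Int.cast : ℤ → ℝ) = M := by
    ext i j
    rw [hrow i]
    rfl
  have hMw : ∀ i, M.mulVec w i = (extRows A).mulVec w (row i) := fun i => by
    simp only [Matrix.mulVec, hrow i]
  obtain ⟨r, hr⟩ : ∃ r, row r = Sum.inr j₀ := by
    by_contra! hc
    have : M.mulVec w = 0 := funext fun i => by
      rw [hMw]; exact (hrow' i).resolve_right (hc i)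
    exact hw0 (Matrix.mulVec_injective_of_isUnit hMu (by rw [this, Matrix.mulVec_zero]))
  have hrow_inj : Function.Injective row := by
    intro i i' hii
    by_contra hne
    have : M.det = 0 := Matrix.det_zero_of_row_eq hne (by rw [hrow i, hrow i', hii])
    exact ((Matrix.isUnit_iff_isUnit_det M).1 hMu).ne_zero this
  have hMw' : M.mulVec w = w j₀ • Pi.single r (1 : ℝ) := by
    ext i
    rw [hMw]
    by_cases hi : i = r
    · subst hi
      simp [hr, extRows_mulVec_inr]
    · have : row i ≠ Sum.inr j₀ := fun h => hi (hrow_inj (h.trans hr.symm))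
      simp [(hrow' i).resolve_right this, hi]
  have hdet : M.det ≠ 0 := ((Matrix.isUnit_iff_isUnit_det M).1 hMu).ne_zero
  let v : Fin n → ℤ := fun j => N.adjugate j r
  have hvM : ∀ j, (v j : ℝ) = M.adjugate j r := fun j => by
    have := (Int.castRingHom ℝ).map_adjugate N
    have := congrFun (congrFun this j) r
    rw [← hNM]
    simpa [v] using this
  have hvw : (fun j => (v j : ℝ)) = (M.det / w j₀) • w := by
    have h1 : M.det • w = w j₀ • fun j => (v j : ℝ) := by
      have := congrArg (M.adjugate.mulVec) hMw'
      rw [Matrix.mulVec_mulVec, Matrix.adjugate_mul, Matrix.smul_mulVec, Matrix.one_mulVec,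
        Matrix.mulVec_smul, Matrix.mulVec_single_one] at this
      rw [this]
      congr 1
      ext j
      exact (hvM j).symm
    rw [div_eq_inv_mul, mul_smul, h1, smul_smul, inv_mul_cancel₀ hj₀, one_smul]
  have hvbound : ∀ j, |v j| ≤ Δ := fun j => by
    change |N.adjugate j r| ≤ Δ
    rw [Matrix.adjugate_apply]
    have hunit : ∀ l : Fin n, IsUnitLike (Pi.single l (1 : ℤ) : Fin n → ℤ) := fun l =>
      ⟨l, by simp, fun l' hl' => by simp [hl']⟩
    refine abs_det_le_of_rows hΔ hΔ1 n _ id Function.injective_id fun i => ?_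
    by_cases hi : i = r
    · subst hi
      exact Or.inr (by rw [Matrix.updateRow_self]; exact hunit j)
    · rw [Matrix.updateRow_ne hi]
      rcases hri : row i with a | l
      · exact Or.inl ⟨a, fun l => by simp [N, E, hri]⟩
      · refine Or.inr ?_
        have : N i = Pi.single l 1 := by
          ext l'
          simp [N, E, hri, Matrix.one_apply, Pi.single_apply, eq_comm]
        rw [this]
        exact hunit l
  have hc0 : M.det / w j₀ ≠ 0 := div_ne_zero hdet hj₀
  have hv0 : v ≠ 0 := by
    intro h0
    have : (M.det / w j₀) • w = 0 := by rw [← hvw, h0]; ext; simp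
    exact (smul_ne_zero hc0 hw0) this
  rcases lt_or_gt_of_ne hc0 with hneg | hpos
  · refine ⟨-v, neg_ne_zero.2 hv0, fun j => by simpa using hvbound j, ?_⟩
    have : (fun j => (((-v) j : ℤ) : ℝ)) = (-(M.det / w j₀)) • w := by
      rw [neg_smul, ← hvw]; ext; simp
    rw [this]
    exact hwu.smul (by linarith)
  · exact ⟨v, hv0, hvbound, by rw [hvw]; exact hwu.smul hpos.le⟩

/-- The vectors vanishing under every row of `D` that vanishes on `u`. -/
def zeroKer {ι : Type*} (D : Matrix ι (Fin n) ℝ) (u : Fin n → ℝ) : Submodule ℝ (Fin n → ℝ) where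
  carrier := {x | ∀ i, D.mulVec u i = 0 → D.mulVec x i = 0}
  add_mem' hx hy i hi := by simp [Matrix.mulVec_add, hx i hi, hy i hi]
  zero_mem' i _ := by simp
  smul_mem' c x hx i hi := by simp [Matrix.mulVec_smul, hx i hi]

/-- Sign-compatible integer decomposition with as many terms as the dimension. -/
lemma exists_decomposition {Δ : ℤ} (hΔ : MaxSubdet A Δ) (hΔ1 : 1 ≤ Δ) (d : ℕ) :
    ∀ u : Fin n → ℝ, Module.finrank ℝ (zeroKer (extRows A) u) ≤ d →
      ∃ (v : Fin d → Fin n → ℤ) (lam : Fin d → ℝ), (∀ j, 0 ≤ lam j) ∧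
        (∀ j l, |v j l| ≤ Δ) ∧
        (∀ j, SignConformal (extRows A) (fun l => (v j l : ℝ)) u) ∧
        u = ∑ j, lam j • fun l => (v j l : ℝ) := by
  induction d with
  | zero =>
    intro u hu
    have hbot : zeroKer (extRows A) u = ⊥ := Submodule.finrank_eq_zero.1 (Nat.le_zero.1 hu)
    have hmem : u ∈ zeroKer (extRows A) u := fun _ => id
    rw [hbot, Submodule.mem_bot] at hmem
    exact ⟨Fin.elim0, Fin.elim0, fun j => j.elim0, fun j => j.elim0, fun j => j.elim0,
      by simp [hmem]⟩
  | succ d ih =>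
    intro u hu
    by_cases hu0 : u = 0
    · subst hu0
      refine ⟨fun _ => 0, fun _ => 0, by simp, ?_, ?_, by simp⟩
      · intro j l
        simpa using hΔ1.trans' zero_le_one
      · intro j
        convert SignConformal.refl (extRows A) 0 using 1
        ext
        simp
    obtain ⟨v₀, hv0, hvΔ, hvu⟩ := exists_int_signConformal hΔ hΔ1 hu0
    obtain ⟨i₀, hi₀⟩ : ∃ i, v₀ i ≠ 0 := by
      by_contra! hc
      exact hv0 (funext hc)
    have hpos : ∃ i, 0 < (extRows A).mulVec (fun j => (v₀ j : ℝ)) i * (extRows A).mulVec u i := by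
      refine ⟨Sum.inr i₀, ?_⟩
      have hne : (v₀ i₀ : ℝ) ≠ 0 := by exact_mod_cast hi₀
      have hs := hvu (Sum.inr i₀)
      have hz := hvu.eq_zero (i := Sum.inr i₀)
      simp only [extRows_mulVec_inr] at hs hz ⊢
      rcases lt_trichotomy (u i₀) 0 with h | h | h
      · exact mul_pos_of_neg_of_neg (lt_of_le_of_ne (hs.2 h.le) hne) h
      · exact absurd (hz h) hne
      · exact mul_pos (lt_of_le_of_ne (hs.1 h.le) hne.symm) h
    obtain ⟨t, ht, hconf, i, hi, hi0⟩ :=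
      exists_conformal_sub_smul (fun i hi => hvu.eq_zero hi) hpos
    have hlt : zeroKer (extRows A) (u - t • fun j => (v₀ j : ℝ)) < zeroKer (extRows A) u :=
      ⟨fun x hx l hl => hx l (hconf.eq_zero hl), fun hsub => hi (hsub (fun _ => id) i hi0)⟩
    obtain ⟨v, lam, hlam, hv, hvc, hsum⟩ := ih _
      (Nat.lt_succ_iff.1 ((Submodule.finrank_lt_finrank_of_lt hlt).trans_le hu))
    refine ⟨Fin.cons v₀ v, Fin.cons t lam, ?_, ?_, ?_, ?_⟩
    · exact Fin.cases (by simpa using ht.le) (by simpa using hlam)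
    · exact Fin.cases (by simpa using hvΔ) (by simpa using hv)
    · exact Fin.cases (by simpa using hvu) (fun j => by simpa using (hvc j).trans hconf)
    · rw [Fin.sum_univ_succ]
      simp only [Fin.cons_zero, Fin.cons_succ]
      rw [← hsum]
      abel

lemma SignConformal.abs_le {x u : Fin n → ℝ} (hx : SignConformal (extRows A) x u)
    (hux : SignConformal (extRows A) (u - x) u) (l : Fin n) : |x l| ≤ |u l| := by
  have h1 := hx (Sum.inr l)
  have h2 := hux (Sum.inr l)
  simp only [extRows_mulVec_inr, Pi.sub_apply] at h1 h2
  rcases le_total 0 (u l) with h | h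
  · rw [abs_of_nonneg (h1.1 h), abs_of_nonneg h]
    linarith [h2.1 h]
  · rw [abs_of_nonpos (h1.2 h), abs_of_nonpos h]
    linarith [h2.2 h]

lemma SignConformal.add_mem_polyP {b : Fin m → ℝ} {x y w : Fin n → ℝ} (hx : x ∈ polyP A b)
    (hy : y ∈ polyP A b) (hw : SignConformal (extRows A) w (y - x))
    (hw' : SignConformal (extRows A) (y - x - w) (y - x)) : x + w ∈ polyP A b := by
  intro i
  have h1 := hw (Sum.inl i)
  have h2 := hw' (Sum.inl i)
  have hxi := hx i
  have hyi := hy i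
  simp only [extRows_mulVec_inl, Pi.sub_apply, mul_sub, Finset.sum_sub_distrib] at h1 h2
  simp only [Pi.add_apply, mul_add, Finset.sum_add_distrib]
  rcases le_total (0 : ℝ) (∑ j, (A i j : ℝ) * y j - ∑ j, (A i j : ℝ) * x j) with h | h
  · linarith [h2.1 h]
  · linarith [h1.2 h]

/-- Rounding `u` to a sign-compatible integer vector vanishing on a prescribed set `I` of
coordinates. -/
lemma exists_int_rounding {Δ : ℤ} (hΔ : MaxSubdet A Δ) (hΔ1 : 1 ≤ Δ) (u : Fin n → ℝ)
    (I : Finset (Fin n)) :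
    ∃ w : Fin n → ℤ, SignConformal (extRows A) (fun l => (w l : ℝ)) u ∧
      SignConformal (extRows A) (u - fun l => (w l : ℝ)) u ∧ (∀ i ∈ I, w i = 0) ∧
      ∀ l, |u l - w l| ≤ Δ * (n + ∑ i ∈ I, |u i|) := by
  classical
  obtain ⟨v, lam, hlam, hv, hvc, hsum⟩ := exists_decomposition hΔ hΔ1 n u
    ((Submodule.finrank_le _).trans (by simp))
  let mu : Fin n → ℤ := fun j => if ∃ i ∈ I, v j i ≠ 0 then 0 else ⌊lam j⌋
  have hmu0 : ∀ j, (0 : ℝ) ≤ mu j := fun j => by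
    simp only [mu]
    split_ifs
    · simp
    · exact_mod_cast Int.floor_nonneg.2 (hlam j)
  have hmule : ∀ j, (mu j : ℝ) ≤ lam j := fun j => by
    simp only [mu]
    split_ifs
    · simpa using hlam j
    · exact Int.floor_le _
  have hcoord : ∀ l, u l = ∑ j, lam j * v j l := fun l => by
    conv_lhs => rw [hsum]
    simp
  have hw : (fun l => ((∑ j, mu j * v j l : ℤ) : ℝ)) =
      ∑ j, (mu j : ℝ) • fun l => (v j l : ℝ) := by
    ext l
    simp
  have hr : (u - fun l => ((∑ j, mu j * v j l : ℤ) : ℝ)) =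
      ∑ j, (lam j - mu j) • fun l => (v j l : ℝ) := by
    rw [hw]
    conv_lhs => rw [hsum]
    rw [← Finset.sum_sub_distrib]
    simp only [sub_smul]
  have habs : ∀ i, ∑ j, lam j * |(v j i : ℝ)| = |u i| := fun i => by
    have hs := fun j => hvc j (Sum.inr i)
    simp only [extRows_mulVec_inr] at hs
    rcases le_total 0 (u i) with h | h
    · rw [abs_of_nonneg h, hcoord i]
      exact Finset.sum_congr rfl fun j _ => by rw [abs_of_nonneg ((hs j).1 h)]
    · rw [abs_of_nonpos h, hcoord i, ← Finset.sum_neg_distrib]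
      exact Finset.sum_congr rfl fun j _ => by rw [abs_of_nonpos ((hs j).2 h), mul_neg]
  have hterm : ∀ j, lam j - mu j ≤ 1 + ∑ i ∈ I, lam j * |(v j i : ℝ)| := fun j => by
    have hnn : ∀ i ∈ I, 0 ≤ lam j * |(v j i : ℝ)| := fun i _ =>
      mul_nonneg (hlam j) (abs_nonneg _)
    by_cases hj : ∃ i ∈ I, v j i ≠ 0
    · have hmu : mu j = 0 := if_pos hj
      obtain ⟨i, hi, hne⟩ := hj
      have h1 : (1 : ℝ) ≤ |(v j i : ℝ)| := by exact_mod_cast Int.one_le_abs hne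
      have h2 := Finset.single_le_sum hnn hi
      have h3 := mul_le_mul_of_nonneg_left h1 (hlam j)
      rw [hmu]
      push_cast
      linarith
    · have hmu : mu j = ⌊lam j⌋ := if_neg hj
      rw [hmu]
      linarith [Int.lt_floor_add_one (lam j), Finset.sum_nonneg hnn]
  refine ⟨fun l => ∑ j, mu j * v j l, ?_, ?_, fun i hi => ?_, fun l => ?_⟩
  · rw [hw]
    exact SignConformal.sum _ fun j _ => (hvc j).smul (hmu0 j)
  · rw [hr]
    exact SignConformal.sum _ fun j _ => (hvc j).smul (sub_nonneg.2 (hmule j))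
  · refine Finset.sum_eq_zero fun j _ => ?_
    by_cases hj : v j i = 0
    · rw [hj, mul_zero]
    · rw [show mu j = 0 from if_pos ⟨i, hi, hj⟩, zero_mul]
  · have hl := congrFun hr l
    simp only [Pi.sub_apply, Finset.sum_apply, Pi.smul_apply, smul_eq_mul] at hl
    rw [hl]
    calc |∑ j, (lam j - mu j) * (v j l : ℝ)| ≤ ∑ j, |(lam j - mu j) * (v j l : ℝ)| :=
          Finset.abs_sum_le_sum_abs _ _
      _ ≤ ∑ j, (1 + ∑ i ∈ I, lam j * |(v j i : ℝ)|) * Δ := by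
          refine Finset.sum_le_sum fun j _ => ?_
          rw [abs_mul, abs_of_nonneg (sub_nonneg.2 (hmule j))]
          have hvΔ : |(v j l : ℝ)| ≤ Δ := by exact_mod_cast hv j l
          exact mul_le_mul (hterm j) hvΔ (abs_nonneg _)
            ((sub_nonneg.2 (hmule j)).trans (hterm j))
      _ = Δ * (n + ∑ i ∈ I, |u i|) := by
          rw [← Finset.sum_mul, mul_comm, Finset.sum_add_distrib, Finset.sum_comm]
          simp [habs]

end ExtRows

/-- A set of indices of small total weight, compared to which all other weights are large. -/
lemma exists_threshold_finset {k : ℕ} (a : Fin k → ℝ) {N c : ℝ} (hc : 0 ≤ c) :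
    ∃ I : Finset (Fin k), N + ∑ i ∈ I, a i ≤ N * (c + 1) ^ I.card ∧
      ∀ i ∉ I, c * (N + ∑ i ∈ I, a i) ≤ a i := by
  classical
  obtain ⟨I, hI, hmax⟩ := Set.exists_max_image
    {I : Finset (Fin k) | N + ∑ i ∈ I, a i ≤ N * (c + 1) ^ I.card} Finset.card
    (Set.toFinite _) ⟨∅, by simp⟩
  have hI' : N + ∑ i ∈ I, a i ≤ N * (c + 1) ^ I.card := hI
  refine ⟨I, hI', fun i hi => ?_⟩
  by_contra! hlt
  have hmem : N + ∑ l ∈ insert i I, a l ≤ N * (c + 1) ^ (insert i I).card := by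
    rw [Finset.sum_insert hi, Finset.card_insert_of_notMem hi, pow_succ]
    nlinarith [mul_le_mul_of_nonneg_right hI' (by linarith : (0 : ℝ) ≤ c + 1)]
  have := hmax _ hmem
  rw [Finset.card_insert_of_notMem hi] at this
  omega

lemma isEpsApprox_of_le {α : Type*} {f : α → ℝ} {S : Set α} {xopt x y : α} {ε : ℝ}
    (hε : 0 ≤ ε) (hx : x ∈ S) (hy : y ∈ S) (h : f x - f xopt ≤ ε * (f y - f xopt)) :
    IsEpsApprox f S xopt ε x := by
  refine ⟨hx, ?_⟩
  calc (f x : EReal) - f xopt ≤ (ε : EReal) * ((f y : EReal) - f xopt) := by exact_mod_cast h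
    _ ≤ _ := by
      refine mul_le_mul_of_nonneg_left (EReal.sub_le_sub ?_ le_rfl) (by exact_mod_cast hε)
      exact le_iSup₂ (f := fun y (_ : y ∈ S) => (f y : EReal)) y hy

/-- The parallelogram identity for a separable quadratic function. -/
lemma separable_quadratic_parallelogram {n k : ℕ} (hkn : k ≤ n) {h : Fin n → ℝ} {q : Fin k → ℝ}
    {f : (Fin n → ℝ) → ℝ}
    (hf : ∀ x, f x = (∑ i : Fin k, -(q i) * (x (Fin.castLE hkn i)) ^ 2) + ∑ j, h j * x j)
    {x y z t : Fin n → ℝ} (hsum : ∀ l, x l + y l = z l + t l) :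
    f x + f y = f z + f t + 2 * ∑ i : Fin k, q i * ((x (Fin.castLE hkn i) - t (Fin.castLE hkn i)) *
      (y (Fin.castLE hkn i) - t (Fin.castLE hkn i))) := by
  have hz : ∀ l, z l = x l + y l - t l := fun l => by linarith [hsum l]
  simp only [hf, hz]
  have hlin : ∑ j, h j * x j + ∑ j, h j * y j =
      ∑ j, h j * (x j + y j - t j) + ∑ j, h j * t j := by
    simp only [← Finset.sum_add_distrib]
    exact Finset.sum_congr rfl fun j _ => by ring
  have hquad : ∀ X Y T : Fin k → ℝ, ∑ i, -q i * X i ^ 2 + ∑ i, -q i * Y i ^ 2 =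
      ∑ i, -q i * (X i + Y i - T i) ^ 2 + ∑ i, -q i * T i ^ 2 +
        2 * ∑ i, q i * ((X i - T i) * (Y i - T i)) := fun X Y T => by
    simp only [Finset.mul_sum, ← Finset.sum_add_distrib]
    exact Finset.sum_congr rfl fun j _ => by ring
  linarith [hquad (fun i => x (Fin.castLE hkn i)) (fun i => y (Fin.castLE hkn i))
    (fun i => t (Fin.castLE hkn i))]

/-- **Theorem 1(ii)**: proximity of an optimal solution of (IQP) to an ε-approximate
solution of (QP). -/
theorem stmt1 {n m k : ℕ} (hn : 1 ≤ n) (hm : 1 ≤ m) (hkn : k ≤ n)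
    (A : Matrix (Fin m) (Fin n) ℤ) (b : Fin m → ℝ) (h : Fin n → ℝ)
    (q : Fin k → ℝ) (hq : ∀ i, 0 < q i)
    (Δ : ℤ) (hΔ : MaxSubdet A Δ)
    (f : (Fin n → ℝ) → ℝ)
    (hf : ∀ x, f x = (∑ i : Fin k, -(q i) * (x (Fin.castLE hkn i)) ^ 2) + ∑ j, h j * x j)
    (xd : Fin n → ℝ) (hxd : IsOptimalSol f (polyP A b ∩ intPts n) xd)
    (xc : Fin n → ℝ) (hxc : IsOptimalSol f (polyP A b) xc)
    (ε : ℝ) (hε0 : 0 < ε) (hε1 : ε ≤ 1) :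
    ∃ xstar : Fin n → ℝ, IsEpsApprox f (polyP A b) xc ε xstar ∧
      ‖xstar - xd‖ ≤ (n : ℝ) * (Δ : ℝ) * ((10 * (Δ : ℝ)) / ε + 1) ^ k := by
  have hΔ0 : 0 ≤ Δ := by
    obtain ⟨r, fr, fc, -, -, -, hr⟩ := hΔ.2
    exact hr ▸ abs_nonneg _
  have hxdP : xd ∈ polyP A b := hxd.1.1
  have hxcP : xc ∈ polyP A b := hxc.1
  have hεΔ : 0 ≤ 10 * (Δ : ℝ) / ε := by positivity
  rcases hΔ0.eq_or_lt with hΔz | hΔpos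
  · have hA : ∀ i j, A i j = 0 := fun i j => by
      have := hΔ.1 1 (fun _ => i) (fun _ => j) one_pos (Function.injective_of_subsingleton _)
        (Function.injective_of_subsingleton _)
      simpa [← hΔz] using this
    have hrefl : xc + (xc - xd) ∈ polyP A b := fun i => by simpa [hA] using hxcP i
    have hle := hxc.2 _ hrefl
    have hsum : f (xc + (xc - xd)) + f xd = 2 * f xc
        - 2 * ∑ i : Fin k, q i * (xc (Fin.castLE hkn i) - xd (Fin.castLE hkn i)) ^ 2 := by
      rw [separable_quadratic_parallelogram hkn hf (z := xc) (t := xc)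
        (fun l => by simp only [Pi.add_apply, Pi.sub_apply]; ring), two_mul (f xc),
        sub_eq_add_neg (f xc + f xc),
        ← mul_neg, ← Finset.sum_neg_distrib]
      congr 2
      exact Finset.sum_congr rfl fun i _ => by simp only [Pi.add_apply, Pi.sub_apply]; ring
    have hnn : 0 ≤ ∑ i : Fin k, q i * (xc (Fin.castLE hkn i) - xd (Fin.castLE hkn i)) ^ 2 :=
      Finset.sum_nonneg fun i _ => mul_nonneg (hq i).le (sq_nonneg _)
    refine ⟨xd, isEpsApprox_of_le hε0.le hxdP hxcP ?_, by simp [← hΔz]⟩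
    linarith
  have hΔR : (0 : ℝ) < Δ := by exact_mod_cast hΔpos
  set u := xc - xd with hu
  obtain ⟨I, hI, hIc⟩ := exists_threshold_finset (fun i => |u (Fin.castLE hkn i)|)
    (N := (n : ℝ)) hεΔ
  obtain ⟨w, hwu, hwu', hwI, hwb⟩ := exists_int_rounding hΔ hΔpos u
    (I.map (Fin.castLEEmb hkn))
  simp only [Finset.sum_map, Finset.mem_map, Fin.castLEEmb_apply, forall_exists_index, and_imp,
    forall_apply_eq_imp_iff₂] at hwI hwb
  have hyd : xd + (fun l => (w l : ℝ)) ∈ polyP A b := hwu.add_mem_polyP hxdP hxcP hwu'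
  have hyc : xd + (u - fun l => (w l : ℝ)) ∈ polyP A b :=
    hwu'.add_mem_polyP hxdP hxcP (by rwa [sub_sub_cancel])
  have hmid : (fun l => (xc l + xd l) / 2) ∈ polyP A b := fun i => by
    have h1 := hxdP i
    have h2 := hxcP i
    have : ∑ j, (A i j : ℝ) * ((xc j + xd j) / 2) =
        (∑ j, (A i j : ℝ) * xc j + ∑ j, (A i j : ℝ) * xd j) / 2 := by
      rw [← Finset.sum_add_distrib, Finset.sum_div]
      exact Finset.sum_congr rfl fun j _ => by ring
    rw [this]
    linarith
  have hint : xd + (fun l => (w l : ℝ)) ∈ intPts n := fun l => by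
    obtain ⟨z, hz⟩ := hxd.1.2 l
    exact ⟨z + w l, by simp [hz]⟩
  have hfd := hxd.2 _ ⟨hyd, hint⟩
  have hcd := hxc.2 _ hxdP
  let Q := ∑ i : Fin k, q i * u (Fin.castLE hkn i) ^ 2
  have hfmid : 2 * f (fun l => (xc l + xd l) / 2) = f xc + f xd + Q / 2 := by
    rw [two_mul, separable_quadratic_parallelogram hkn hf (z := xc) (t := xd)
      (fun l => by ring), Finset.mul_sum, Finset.sum_div]
    congr 1
    exact Finset.sum_congr rfl fun i _ => by simp only [hu, Pi.sub_apply]; ring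
  have hfx : f (xd + (u - fun l => (w l : ℝ))) + f (xd + fun l => (w l : ℝ)) = f xc + f xd +
      ∑ i : Fin k, 2 * (q i * (w (Fin.castLE hkn i) *
        (u (Fin.castLE hkn i) - w (Fin.castLE hkn i)))) := by
    rw [separable_quadratic_parallelogram hkn hf (z := xc) (t := xd)
      (fun l => by simp only [hu, Pi.add_apply, Pi.sub_apply]; ring), Finset.mul_sum]
    congr 1
    exact Finset.sum_congr rfl fun i _ => by simp only [Pi.add_apply, Pi.sub_apply]; ring
  have hcross : ∑ i : Fin k, 2 * (q i * (w (Fin.castLE hkn i) *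
      (u (Fin.castLE hkn i) - w (Fin.castLE hkn i)))) ≤ ε / 4 * Q := by
    rw [Finset.mul_sum]
    refine Finset.sum_le_sum fun i _ => ?_
    set l := Fin.castLE hkn i with hl
    have hq' := hq i
    have hsq : 0 ≤ q i * u l ^ 2 := by positivity
    by_cases hi : i ∈ I
    · rw [hwI i hi]
      simpa using mul_nonneg (by positivity : 0 ≤ ε / 4) hsq
    · have h1 := hIc i hi
      have h2 : |u l - w l| ≤ ε / 10 * |u l| := by
        refine (hwb l).trans ?_
        rw [div_mul_eq_mul_div, div_le_iff₀ hε0] at h1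
        linarith
      have h3 : |(w l : ℝ)| ≤ |u l| := hwu.abs_le hwu' l
      have h4 : (w l : ℝ) * (u l - w l) ≤ ε / 10 * u l ^ 2 := by
        calc (w l : ℝ) * (u l - w l) ≤ |(w l : ℝ)| * |u l - w l| := by
              rw [← abs_mul]; exact le_abs_self _
          _ ≤ |u l| * (ε / 10 * |u l|) := mul_le_mul h3 h2 (abs_nonneg _) (abs_nonneg _)
          _ = ε / 10 * u l ^ 2 := by rw [← sq_abs (u l)]; ring
      have h5 := mul_le_mul_of_nonneg_left h4 hq'.le
      have h6 := mul_nonneg hε0.le hsq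
      linarith
  refine ⟨xd + (u - fun l => (w l : ℝ)), isEpsApprox_of_le hε0.le hyc hmid ?_, ?_⟩
  · have : ε / 4 * Q ≤ ε * (f (fun l => (xc l + xd l) / 2) - f xc) := by
      rw [div_mul_eq_mul_div, mul_div_assoc]
      exact mul_le_mul_of_nonneg_left (by linarith) hε0.le
    linarith
  · have hbound : (Δ : ℝ) * (n + ∑ i ∈ I, |u (Fin.castLE hkn i)|) ≤
        n * Δ * (10 * Δ / ε + 1) ^ k := by
      calc (Δ : ℝ) * (n + ∑ i ∈ I, |u (Fin.castLE hkn i)|)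
          ≤ Δ * (n * (10 * Δ / ε + 1) ^ I.card) := mul_le_mul_of_nonneg_left hI hΔR.le
        _ ≤ Δ * (n * (10 * Δ / ε + 1) ^ k) := by
          have hcard : I.card ≤ k := by simpa using I.card_le_univ
          gcongr
          linarith
        _ = n * Δ * (10 * Δ / ε + 1) ^ k := by ring
    refine (pi_norm_le_iff_of_nonneg (by positivity)).2 fun l => ?_
    simpa using (hwb l).trans hbound
end

section
/- Let P = {x ∈ ℝⁿ : Ax ≤ b} be a polyhedron (A an integer matrix, b real), and let x^a, x^b ∈ P. Let x^∘ ∈ ℝⁿ be a vector that can be written in the two ways x^∘ = x^1 + Σ_{i=1}^m α_i v^i and x^∘ = x^2 − Σ_{i=1}^m β_i v^i, where x^1, x^2 ∈ P and, for i = 1,…,m, α_i and β_i are nonnegative reals and v^i ∈ T(A, x^a, x^b). Then x^∘ ∈ P. -/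
open scoped BigOperators

/-- The polyhedral cone `T(A, xa, xb) = {x : A₁ x ≤ 0, A₂ x ≥ 0}`, where `A₁` consists of
the rows `u` of `A` with `u ⬝ xa ≤ u ⬝ xb` and `A₂` of the rows with `u ⬝ xa ≥ u ⬝ xb`. -/
def coneT {m n : ℕ} (A : Matrix (Fin m) (Fin n) ℤ) (xa xb : Fin n → ℝ) : Set (Fin n → ℝ) :=
  {x | ∀ i : Fin m,
    ((∑ j, (A i j : ℝ) * xa j) ≤ (∑ j, (A i j : ℝ) * xb j) →
      (∑ j, (A i j : ℝ) * x j) ≤ 0) ∧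
    ((∑ j, (A i j : ℝ) * xb j) ≤ (∑ j, (A i j : ℝ) * xa j) →
      0 ≤ (∑ j, (A i j : ℝ) * x j))}

theorem sum_mul_sum_smul_apply {ι κ : Type*} [Fintype ι] [Fintype κ] (u : ι → ℝ)
    (c : κ → ℝ) (v : κ → ι → ℝ) :
    ∑ j, u j * (∑ i, c i • v i) j = ∑ i, c i * ∑ j, u j * v i j := by
  simp only [Finset.sum_apply, Pi.smul_apply, smul_eq_mul, Finset.mul_sum]
  rw [Finset.sum_comm]
  exact Finset.sum_congr rfl fun i _ => Finset.sum_congr rfl fun j _ => by ring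

/-- **Lemma 3**: if `x∘` can be written both as `x¹ + Σ αᵢ vⁱ` and as `x² − Σ βᵢ vⁱ`
with `x¹, x² ∈ P`, `αᵢ, βᵢ ≥ 0` and `vⁱ ∈ T(A, xa, xb)`, then `x∘ ∈ P`. -/
theorem stmt4 {m n M : ℕ} (A : Matrix (Fin m) (Fin n) ℤ) (b : Fin m → ℝ)
    (xa xb : Fin n → ℝ) (hxa : xa ∈ polyP A b) (hxb : xb ∈ polyP A b)
    (x1 x2 : Fin n → ℝ) (hx1 : x1 ∈ polyP A b) (hx2 : x2 ∈ polyP A b)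
    (v : Fin M → Fin n → ℝ) (hv : ∀ i, v i ∈ coneT A xa xb)
    (α β : Fin M → ℝ) (hα : ∀ i, 0 ≤ α i) (hβ : ∀ i, 0 ≤ β i)
    (x0 : Fin n → ℝ)
    (h1 : x0 = x1 + ∑ i, α i • v i)
    (h2 : x0 = x2 - ∑ i, β i • v i) :
    x0 ∈ polyP A b := by
  intro k
  rcases le_total (∑ j, (A k j : ℝ) * xa j) (∑ j, (A k j : ℝ) * xb j) with h | h
  · have hk := hx1 k
    have hs : ∑ i, α i * ∑ j, (A k j : ℝ) * v i j ≤ 0 :=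
      Finset.sum_nonpos fun i _ => mul_nonpos_of_nonneg_of_nonpos (hα i) ((hv i k).1 h)
    rw [← sum_mul_sum_smul_apply] at hs
    simp only [h1, Pi.add_apply, mul_add, Finset.sum_add_distrib]
    linarith
  · have hk := hx2 k
    have hs : 0 ≤ ∑ i, β i * ∑ j, (A k j : ℝ) * v i j :=
      Finset.sum_nonneg fun i _ => mul_nonneg (hβ i) ((hv i k).2 h)
    rw [← sum_mul_sum_smul_apply] at hs
    simp only [h2, Pi.sub_apply, mul_sub, Finset.sum_sub_distrib]
    linarith
end

section
/- Let n, Δ be reals with n ≥ 1 and Δ ≥ 1, let ε ∈ (0,1], and let k ≥ 1 be an integer. Define recursively χ_1 := 8nΔ/ε + 2nΔ and χ_j := 2nΔ + (8/ε)·(Σ_{i=1}^{j−1} Δχ_i + nΔ) for j = 2,…,k, and set ψ_j := Σ_{i=1}^j Δχ_i for j = 1,…,k. Then ψ_k ≤ nΔ·(10Δ/ε + 1)^k − nΔ. -/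
open scoped BigOperators

/-- **Claim 3**: the bound `ψ_k ≤ nΔ (10Δ/ε + 1)^k − nΔ` for the recursively defined
quantities `χ_j` and `ψ_j`. -/
theorem stmt6 (n Δ ε : ℝ) (hn : 1 ≤ n) (hΔ : 1 ≤ Δ) (hε0 : 0 < ε) (hε1 : ε ≤ 1)
    (k : ℕ) (hk : 1 ≤ k) (χ ψ : ℕ → ℝ)
    (hχ1 : χ 1 = 8 * n * Δ / ε + 2 * n * Δ)
    (hχ : ∀ j, 2 ≤ j → j ≤ k →
      χ j = 2 * n * Δ + (8 / ε) * ((∑ i ∈ Finset.Icc 1 (j - 1), Δ * χ i) + n * Δ))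
    (hψ : ∀ j, 1 ≤ j → j ≤ k → ψ j = ∑ i ∈ Finset.Icc 1 j, Δ * χ i) :
    ψ k ≤ n * Δ * (10 * Δ / ε + 1) ^ k - n * Δ := by
  have step : ∀ j, j + 1 ≤ k →
      χ (j + 1) = 2 * n * Δ + 8 / ε * ((∑ i ∈ Finset.Icc 1 j, Δ * χ i) + n * Δ) := by
    intro j hj
    rcases Nat.eq_zero_or_pos j with rfl | hpos
    · simp only [zero_add, hχ1, Finset.Icc_eq_empty_of_lt zero_lt_one, Finset.sum_empty]
      ring
    · simpa using hχ (j + 1) (by omega) hj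
  have hnΔ : 0 < n * Δ := by positivity
  have hr : 1 ≤ 1 / ε := by rwa [le_div_iff₀ hε0, one_mul]
  have bounds : ∀ j, j ≤ k →
      n * Δ ≤ (∑ i ∈ Finset.Icc 1 j, Δ * χ i) + n * Δ ∧
      (∑ i ∈ Finset.Icc 1 j, Δ * χ i) + n * Δ ≤ n * Δ * (10 * Δ / ε + 1) ^ j := by
    intro j
    induction j with
    | zero => simp
    | succ j ih =>
      intro hj
      obtain ⟨lower, upper⟩ := ih (by omega)
      rw [Finset.sum_Icc_succ_top (by omega), step j hj]
      set T := (∑ i ∈ Finset.Icc 1 j, Δ * χ i) + n * Δ with hT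
      have hT0 : 0 < T := hnΔ.trans_le lower
      have rearrange (x : ℝ) : (∑ i ∈ Finset.Icc 1 j, Δ * χ i) + x + n * Δ = T + x := by
        rw [hT]; ring
      rw [rearrange]
      constructor
      · have : 0 ≤ Δ * (2 * n * Δ + 8 / ε * T) := by positivity
        linarith
      · have absorb : n * Δ ≤ 1 / ε * T := by nlinarith
        calc T + Δ * (2 * n * Δ + 8 / ε * T)
            = T + Δ * (8 / ε * T) + 2 * Δ * (n * Δ) := by ring
          _ ≤ T + Δ * (8 / ε * T) + 2 * Δ * (1 / ε * T) := by gcongr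
          _ = T * (10 * Δ / ε + 1) := by ring
          _ ≤ n * Δ * (10 * Δ / ε + 1) ^ j * (10 * Δ / ε + 1) := by gcongr
          _ = n * Δ * (10 * Δ / ε + 1) ^ (j + 1) := by ring
  rw [hψ k hk le_rfl]
  linarith [(bounds k le_rfl).2]
end

section
/- Let n ≥ 1 and Δ be integers, and let A be the (2n) × n integer matrix whose rows are: (1, −Δ, −Δ, …, −Δ); (−1, Δ, Δ, …, Δ); the rows (0, e_i) for i = 1,…,n−1, where e_i are the standard unit rows of length n−1; and the rows (0, −e_i) for i = 1,…,n−1. Then the determinant of every square submatrix of A lies in the set {0, 1, −1, Δ, −Δ}. -/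
open scoped BigOperators

/-- If every row of a square matrix either has entries in `{0, 1, -1}` with at most one nonzero
entry, or is `± v` for a fixed vector `v`, then the determinant lies in every set that contains `0`,
`1` and the entries of `v` and is closed under negation. -/
theorem det_mem_of_rows_unit_or_neg {R : Type*} [CommRing R] {T : Set R} (h0 : 0 ∈ T) (h1 : 1 ∈ T)
    (hneg : ∀ x ∈ T, -x ∈ T) (r : ℕ) (M : Matrix (Fin r) (Fin r) R) (v : Fin r → R)
    (hv : ∀ j, v j ∈ T)
    (hM : ∀ i, ((∀ j, M i j = 0 ∨ M i j = 1 ∨ M i j = -1) ∧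
        ∀ j k, M i j ≠ 0 → M i k ≠ 0 → j = k) ∨ M i = v ∨ M i = -v) :
    M.det ∈ T := by
  induction r with
  | zero => simpa using h1
  | succ r ih =>
    by_cases hunit : ∃ i, (∀ j, M i j = 0 ∨ M i j = 1 ∨ M i j = -1) ∧
        ∀ j k, M i j ≠ 0 → M i k ≠ 0 → j = k
    · obtain ⟨i, hval, hsupp⟩ := hunit
      by_cases hz : ∀ j, M i j = 0
      · rwa [Matrix.det_eq_zero_of_row_eq_zero i hz]
      push Not at hz
      obtain ⟨k, hk⟩ := hz
      have hminor : (M.submatrix i.succAbove k.succAbove).det ∈ T := by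
        refine ih _ (v ∘ k.succAbove) (fun j => hv _) fun a => ?_
        rcases hM (i.succAbove a) with ⟨ha, hb⟩ | h | h
        · exact Or.inl ⟨fun j => ha _, fun j l hj hl =>
            Fin.succAbove_right_injective (hb _ _ hj hl)⟩
        · exact Or.inr (Or.inl (funext fun j => congrFun h _))
        · exact Or.inr (Or.inr (funext fun j => congrFun h _))
      rw [Matrix.det_succ_row M i, Finset.sum_eq_single k]
      · rcases hval k with h | h | h
        · exact absurd h hk
        · rcases neg_one_pow_eq_or R (i + k : ℕ) with hs | hs <;>
            simp [h, hs, hminor, hneg]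
        · rcases neg_one_pow_eq_or R (i + k : ℕ) with hs | hs <;>
            simp [h, hs, hminor, hneg]
      · intro j _ hjk
        have : M i j = 0 := by
          by_contra hj
          exact hjk (hsupp j k hj hk)
        simp [this]
      · simp
    · have hfull : ∀ i, M i = v ∨ M i = -v := fun i =>
        (hM i).resolve_left fun h => hunit ⟨i, h⟩
      rcases r with _ | r
      · rw [Matrix.det_fin_one]
        rcases hfull 0 with h | h <;> rw [h]
        · exact hv 0
        · exact hneg _ (hv 0)
      · have h01 : (0 : Fin (r + 2)) ≠ 1 := Fin.zero_ne_one
        have hrows : M 0 = M 1 ∨ M 0 = -M 1 := by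
          rcases hfull 0 with h | h <;> rcases hfull 1 with h' | h' <;> simp [h, h']
        suffices M.det = 0 by rwa [this]
        rcases hrows with h | h
        · exact Matrix.det_zero_of_row_eq h01 h
        · rw [← Matrix.det_updateRow_add_self M h01]
          refine Matrix.det_eq_zero_of_row_eq_zero 0 fun j => ?_
          simp [h]

/-- **Observation 2**: every subdeterminant of the constraint matrix of `P̄` lies in
`{0, ±1, ±Δ}`. The matrix `A` has `2n` rows: `(1, −Δ, …, −Δ)`, `(−1, Δ, …, Δ)`,
the rows `(0, eᵢ)` for `i = 1, …, n−1`, and the rows `(0, −eᵢ)` for `i = 1, …, n−1`. -/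
theorem stmt7 (n : ℕ) (hn : 1 ≤ n) (Δ : ℤ) (A : Matrix (Fin (2 * n)) (Fin n) ℤ)
    (hA : ∀ (r : Fin (2 * n)) (j : Fin n),
      A r j = if (r : ℕ) = 0 then (if (j : ℕ) = 0 then 1 else -Δ)
        else if (r : ℕ) = 1 then (if (j : ℕ) = 0 then -1 else Δ)
        else if (r : ℕ) ≤ n then (if (j : ℕ) = (r : ℕ) - 1 then 1 else 0)
        else (if (j : ℕ) = (r : ℕ) - n then -1 else 0)) :
    ∀ (r : ℕ) (fr : Fin r → Fin (2 * n)) (fc : Fin r → Fin n),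
      Function.Injective fr → Function.Injective fc →
      (A.submatrix fr fc).det ∈ ({0, 1, -1, Δ, -Δ} : Set ℤ) := by
  intro r fr fc _ hfc
  refine det_mem_of_rows_unit_or_neg (by simp) (by simp) ?_ r _
    (fun j => if (fc j : ℕ) = 0 then 1 else -Δ) ?_ fun i => ?_
  · rintro x (rfl | rfl | rfl | rfl | rfl) <;> simp
  · intro j
    split_ifs <;> simp
  · by_cases hr0 : (fr i : ℕ) = 0
    · right; left
      funext j
      simp [hA, hr0]
    by_cases hr1 : (fr i : ℕ) = 1
    · right; right
      funext j
      simp only [Matrix.submatrix_apply, hA, hr1, Pi.neg_apply]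
      split_ifs <;> simp_all
    left
    simp only [Matrix.submatrix_apply, hA, hr0, hr1, if_false]
    refine ⟨fun j => ?_, fun j k hj hk => hfc (Fin.ext ?_)⟩
    · split_ifs <;> simp
    · split_ifs at hj hk <;> omega
end

section
/- Every x ∈ P̄ satisfies x_1 ≤ t + (n−1)βΔ, and the vector v := (t + (n−1)βΔ, β, β, …, β) is the unique point of P̄ with x_1 = t + (n−1)βΔ. In particular, v is the unique optimal solution of the linear program max{x_1 : x ∈ P̄}. -/
open scoped BigOperators

/-- The polytope `P̄` of Definition 1: `−t ≤ x₁ − Δ Σ_{i≥2} xᵢ ≤ t`, `0 ≤ xᵢ ≤ β` for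
`i = 2, …, n` (here coordinates are indexed by `Fin n`, so `x₁` is `x ⟨0, hn⟩`). -/
def Pbar (n : ℕ) (hn : 0 < n) (Δ t : ℤ) (β : ℝ) : Set (Fin n → ℝ) :=
  {x | -(t : ℝ) ≤ x ⟨0, hn⟩ -
        (Δ : ℝ) * ∑ i ∈ Finset.univ.filter (fun i : Fin n => 0 < (i : ℕ)), x i ∧
      x ⟨0, hn⟩ -
        (Δ : ℝ) * ∑ i ∈ Finset.univ.filter (fun i : Fin n => 0 < (i : ℕ)), x i ≤ (t : ℝ) ∧
      ∀ i : Fin n, 0 < (i : ℕ) → 0 ≤ x i ∧ x i ≤ β}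

/-- There are `n - 1` indices in `Fin n` other than the first one. -/
lemma card_filter_fin_val_pos (n : ℕ) (hn : 0 < n) :
    ((Finset.univ.filter (fun i : Fin n => 0 < (i : ℕ))).card : ℝ) = (n : ℝ) - 1 := by
  obtain ⟨m, rfl⟩ := Nat.exists_eq_succ_of_ne_zero hn.ne'
  have h : Finset.univ.filter (fun i : Fin (m + 1) => 0 < (i : ℕ)) = Finset.univ.erase 0 := by
    ext i
    simp [Fin.pos_iff_ne_zero]
  rw [h, Finset.card_erase_of_mem (Finset.mem_univ _)]
  simp

/-- The sum over the non-first indices of the constant `β` is `(n - 1) * β`. -/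
lemma sum_filter_fin_val_pos_const (n : ℕ) (hn : 0 < n) (β : ℝ) :
    ∑ _i ∈ Finset.univ.filter (fun i : Fin n => 0 < (i : ℕ)), β = ((n : ℝ) - 1) * β := by
  rw [Finset.sum_const, nsmul_eq_mul, card_filter_fin_val_pos n hn]

/-- Every `x ∈ P̄` satisfies `x₁ ≤ t + (n−1)βΔ`, and
`v = (t + (n−1)βΔ, β, …, β)` is the unique point of `P̄` attaining this bound; hence `v`
is the unique optimal solution of `max {x₁ : x ∈ P̄}`. -/
theorem stmt9 (n : ℕ) (hn : 0 < n) (Δ t : ℤ) (hΔ : 1 ≤ Δ) (ht : 0 ≤ t)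
    (β : ℝ) (hβ0 : 0 < β) (hβ1 : β < 1)
    (v : Fin n → ℝ)
    (hv : v = fun i : Fin n => if (i : ℕ) = 0 then (t : ℝ) + ((n : ℝ) - 1) * β * (Δ : ℝ) else β) :
    (∀ x ∈ Pbar n hn Δ t β, x ⟨0, hn⟩ ≤ (t : ℝ) + ((n : ℝ) - 1) * β * (Δ : ℝ)) ∧
    v ∈ Pbar n hn Δ t β ∧
    (∀ x ∈ Pbar n hn Δ t β,
      x ⟨0, hn⟩ = (t : ℝ) + ((n : ℝ) - 1) * β * (Δ : ℝ) → x = v) := by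
  have hΔ' : (0 : ℝ) < Δ := by exact_mod_cast hΔ
  have ht' : (0 : ℝ) ≤ t := by exact_mod_cast ht
  have hconst := sum_filter_fin_val_pos_const n hn β
  have hle : ∀ x ∈ Pbar n hn Δ t β, ∀ i ∈ Finset.univ.filter (fun i : Fin n => 0 < (i : ℕ)),
      x i ≤ β := fun x hx i hi => (hx.2.2 i (Finset.mem_filter.mp hi).2).2
  refine ⟨fun x hx => ?_, ?_, fun x hx hx0 => ?_⟩
  · have hsum := mul_le_mul_of_nonneg_left (Finset.sum_le_sum (hle x hx)) hΔ'.le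
    rw [hconst] at hsum
    linarith [hx.2.1]
  · have hvβ : ∀ i : Fin n, 0 < (i : ℕ) → v i = β := fun i hi => by simp [hv, hi.ne']
    have hvsum : ∑ i ∈ Finset.univ.filter (fun i : Fin n => 0 < (i : ℕ)), v i
        = ((n : ℝ) - 1) * β := by
      rw [← hconst]
      exact Finset.sum_congr rfl fun i hi => hvβ i (Finset.mem_filter.mp hi).2
    have hv0 : v ⟨0, hn⟩ = (t : ℝ) + ((n : ℝ) - 1) * β * (Δ : ℝ) := by simp [hv]
    refine ⟨?_, ?_, fun i hi => ?_⟩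
    · rw [hvsum, hv0]
      linarith
    · rw [hvsum, hv0]
      linarith
    · rw [hvβ i hi]
      exact ⟨hβ0.le, le_rfl⟩
  · have hsum : ∑ i ∈ Finset.univ.filter (fun i : Fin n => 0 < (i : ℕ)), x i
        = ∑ _i ∈ Finset.univ.filter (fun i : Fin n => 0 < (i : ℕ)), β := by
      refine le_antisymm (Finset.sum_le_sum (hle x hx)) ?_
      rw [hconst]
      refine le_of_mul_le_mul_left ?_ hΔ'
      linarith [hx.2.1]
    have heq := (Finset.sum_eq_sum_iff_of_le (hle x hx)).mp hsum
    ext i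
    rcases Nat.eq_zero_or_pos (i : ℕ) with hi | hi
    · obtain rfl : i = ⟨0, hn⟩ := Fin.ext hi
      simp [hv, hx0]
    · simpa [hv, hi.ne'] using heq i (by simpa using hi)
end

section
/- For every integers n ≥ 2, Δ ≥ 1 and every real β ∈ (0,1), there exist a positive integer m, an integer matrix A ∈ ℤ^{m×n} whose maximum absolute subdeterminant equals Δ, a vector b ∈ ℝ^m, and a vector c ∈ ℝⁿ, such that the integer linear program max{c·x : Ax ≤ b, x ∈ ℤⁿ} has a unique optimal solution x^d, its linear relaxation max{c·x : Ax ≤ b, x ∈ ℝⁿ} has a unique optimal solution x^c, and ‖x^c − x^d‖_∞ = (n−1)βΔ. -/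
open scoped BigOperators

/-- The identity matrix of size `n + 1` with row `0` replaced by `(1, -Δ, …, -Δ)`. -/
def tightMatrix (n : ℕ) (Δ : ℤ) : Matrix (Fin (n + 1)) (Fin (n + 1)) ℤ :=
  Matrix.of (Fin.cons (Fin.cons 1 fun _ => -Δ) fun i => Pi.single i.succ 1)

lemma tightMatrix_zero_zero (n : ℕ) (Δ : ℤ) : tightMatrix n Δ 0 0 = 1 := rfl

lemma tightMatrix_zero_succ (n : ℕ) (Δ : ℤ) (j : Fin n) : tightMatrix n Δ 0 j.succ = -Δ := rfl

lemma tightMatrix_of_ne_zero (n : ℕ) (Δ : ℤ) {i : Fin (n + 1)} (hi : i ≠ 0) (j : Fin (n + 1)) :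
    tightMatrix n Δ i j = if j = i then 1 else 0 := by
  obtain ⟨k, rfl⟩ := Fin.exists_succ_eq.2 hi
  simp [tightMatrix, Pi.single_apply]

lemma abs_tightMatrix_le (n : ℕ) {Δ : ℤ} (hΔ : 1 ≤ Δ) (i j : Fin (n + 1)) :
    |tightMatrix n Δ i j| ≤ if i = 0 then Δ else 1 := by
  split_ifs with hi
  · subst hi
    cases j using Fin.cases with
    | zero => simpa [tightMatrix_zero_zero] using hΔ
    | succ j => simp [tightMatrix_zero_succ, abs_of_nonneg (zero_le_one.trans hΔ)]
  · rw [tightMatrix_of_ne_zero n Δ hi]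
    split_ifs <;> simp

/-- Two permutations that agree away from one point are equal. -/
lemma Equiv.Perm.eq_of_forall_ne_apply_eq {α : Type*} {σ τ : Equiv.Perm α} (a : α)
    (h : ∀ i, i ≠ a → σ i = τ i) : σ = τ := by
  have key : ∀ i, i ≠ a → (τ⁻¹ * σ) i = i := fun i hi => by simp [h i hi]
  have ha : (τ⁻¹ * σ) a = a := by
    by_contra hne
    exact hne ((τ⁻¹ * σ).injective (key _ hne))
  have : τ⁻¹ * σ = 1 := Equiv.ext fun i => by
    by_cases hi : i = a
    · rw [hi, ha, Equiv.Perm.one_apply]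
    · exact key i hi
  exact (inv_mul_eq_one.1 this).symm

/-- A determinant with at most one nonzero term in its Leibniz expansion is bounded by any
bound on the terms. -/
lemma Matrix.abs_det_le_of_forall_prod {ι : Type*} [Fintype ι] [DecidableEq ι]
    (M : Matrix ι ι ℤ) {C : ℤ} (hC : 0 ≤ C)
    (hle : ∀ σ : Equiv.Perm ι, |∏ i, M i (σ i)| ≤ C)
    (huniq : ∀ σ τ : Equiv.Perm ι, ∏ i, M i (σ i) ≠ 0 → ∏ i, M i (τ i) ≠ 0 → σ = τ) :
    |M.det| ≤ C := by
  rw [← Matrix.det_transpose, Matrix.det_apply']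
  simp only [Matrix.transpose_apply]
  by_cases h : ∃ σ : Equiv.Perm ι, ∏ i, M i (σ i) ≠ 0
  · obtain ⟨σ, hσ⟩ := h
    rw [Finset.sum_eq_single σ]
    · have hsign : |((Equiv.Perm.sign σ : ℤˣ) : ℤ)| = 1 := Int.isUnit_iff_abs_eq.1 (Units.isUnit _)
      simpa [abs_mul, hsign] using hle σ
    · intro τ _ hτ
      by_contra hne
      exact hτ (huniq τ σ (right_ne_zero_of_mul hne) hσ)
    · simp
  · push Not at h
    simpa [h] using hC

lemma abs_det_submatrix_tightMatrix_le (n : ℕ) {Δ : ℤ} (hΔ : 1 ≤ Δ) {r : ℕ}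
    {fr fc : Fin r → Fin (n + 1)} (hr : Function.Injective fr) (hc : Function.Injective fc) :
    |((tightMatrix n Δ).submatrix fr fc).det| ≤ Δ := by
  refine Matrix.abs_det_le_of_forall_prod _ (by lia) (fun σ => ?_) fun σ τ hσ hτ => ?_
  · rw [Finset.abs_prod]
    refine (Finset.prod_le_prod (fun _ _ => abs_nonneg _)
      fun i _ => abs_tightMatrix_le n hΔ (fr i) (fc (σ i))).trans ?_
    by_cases h : ∃ a, fr a = 0
    · obtain ⟨a, ha⟩ := h
      rw [Finset.prod_eq_single a]
      · simp [ha]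
      · intro i _ hi
        exact if_neg fun h0 => hi (hr (h0.trans ha.symm))
      · simp
    · push Not at h
      simpa [h] using hΔ
  · have entry : ∀ {ρ : Equiv.Perm (Fin r)},
        ∏ i, (tightMatrix n Δ).submatrix fr fc i (ρ i) ≠ 0 → ∀ i, fr i ≠ 0 → fc (ρ i) = fr i := by
      intro ρ hρ i hi
      have := Finset.prod_ne_zero_iff.1 hρ i (Finset.mem_univ i)
      rw [Matrix.submatrix_apply, tightMatrix_of_ne_zero n Δ hi] at this
      by_contra hne
      exact this (if_neg hne)
    have agree : ∀ i, fr i ≠ 0 → σ i = τ i := fun i hi =>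
      hc ((entry hσ i hi).trans (entry hτ i hi).symm)
    by_cases h : ∃ a, fr a = 0
    · obtain ⟨a, ha⟩ := h
      exact Equiv.Perm.eq_of_forall_ne_apply_eq a fun i hi =>
        agree i fun h0 => hi (hr (h0.trans ha.symm))
    · push Not at h
      exact Equiv.ext fun i => agree i (h i)

lemma maxSubdet_tightMatrix (n : ℕ) {Δ : ℤ} (hΔ : 1 ≤ Δ) :
    MaxSubdet (tightMatrix (n + 1) Δ) Δ := by
  refine ⟨fun r fr fc _ hr hc => abs_det_submatrix_tightMatrix_le _ hΔ hr hc,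
    1, fun _ => 0, fun _ => Fin.succ 0, one_pos, Function.injective_of_subsingleton _,
    Function.injective_of_subsingleton _, ?_⟩
  rw [Matrix.det_fin_one, Matrix.submatrix_apply, tightMatrix_zero_succ, abs_neg,
    abs_of_nonneg (by lia)]

lemma mem_polyP_tightMatrix {n : ℕ} {Δ : ℤ} {β : ℝ} {x : Fin (n + 1) → ℝ} :
    x ∈ polyP (tightMatrix n Δ) (Fin.cons 0 fun _ => β) ↔
      x 0 ≤ Δ * ∑ j : Fin n, x j.succ ∧ ∀ j : Fin n, x j.succ ≤ β := by
  simp only [polyP, Set.mem_ofPred_eq, Fin.forall_fin_succ (n := n), Fin.cons_zero, Fin.cons_succ,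
    tightMatrix_of_ne_zero n Δ (Fin.succ_ne_zero _)]
  rw [Fin.sum_univ_succ]
  simp [tightMatrix_zero_zero, tightMatrix_zero_succ, ← Finset.mul_sum]

/-- On `{x : x₀ ≤ Δ ∑ xⱼ, xⱼ ≤ γ}` with `Δ > 0`, the first coordinate is uniquely maximized at
`(nγΔ, γ, …, γ)`. -/
lemma apply_zero_lt_of_ne {n : ℕ} {Δ γ : ℝ} (hΔ : 0 < Δ) {x : Fin (n + 1) → ℝ}
    (h0 : x 0 ≤ Δ * ∑ j : Fin n, x j.succ) (hj : ∀ j : Fin n, x j.succ ≤ γ)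
    (hne : x ≠ Fin.cons (n * γ * Δ) fun _ => γ) : x 0 < n * γ * Δ := by
  have hcard : ∑ _j : Fin n, γ = n * γ := by simp
  by_contra! hge
  have hsum : ∑ j : Fin n, x j.succ = ∑ _j : Fin n, γ := by
    refine le_antisymm (Finset.sum_le_sum fun j _ => hj j) ?_
    rw [hcard]
    exact le_of_mul_le_mul_left (by linarith) hΔ
  have heq := (Finset.sum_eq_sum_iff_of_le fun j _ => hj j).1 hsum
  refine hne (funext fun i => ?_)
  cases i using Fin.cases with
  | zero =>
    rw [hsum, hcard] at h0
    rw [Fin.cons_zero]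
    linarith
  | succ j => simpa using heq j (Finset.mem_univ j)

lemma norm_cons_const {n : ℕ} {γ δ : ℝ} (hγ : 0 ≤ γ) (h : γ ≤ δ) :
    ‖(Fin.cons δ fun _ => γ : Fin (n + 1) → ℝ)‖ = δ := by
  have hδ : 0 ≤ δ := hγ.trans h
  refine le_antisymm ((pi_norm_le_iff_of_nonneg hδ).2 fun i => ?_) ?_
  · cases i using Fin.cases with
    | zero => simp [abs_of_nonneg hδ]
    | succ j => simpa [abs_of_nonneg hγ] using h
  · simpa [abs_of_nonneg hδ] using
      norm_le_pi_norm (Fin.cons δ fun _ => γ : Fin (n + 1) → ℝ) 0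

/-- **Proposition 1**: tightness of the Cook–Gerards–Schrijver–Tardos bound: there is an
(ILP) instance with subdeterminant `Δ` whose unique integer optimum `x^d` and unique LP
optimum `x^c` satisfy `‖x^c − x^d‖_∞ = (n−1)βΔ`. -/
theorem stmt11 (n : ℕ) (hn : 2 ≤ n) (Δ : ℤ) (hΔ : 1 ≤ Δ)
    (β : ℝ) (hβ0 : 0 < β) (hβ1 : β < 1) :
    ∃ (m : ℕ) (_ : 0 < m) (A : Matrix (Fin m) (Fin n) ℤ) (b : Fin m → ℝ) (c : Fin n → ℝ)
      (xd xc : Fin n → ℝ),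
      MaxSubdet A Δ ∧
      xd ∈ polyP A b ∩ intPts n ∧
      (∀ x ∈ polyP A b ∩ intPts n, x ≠ xd → ∑ j, c j * x j < ∑ j, c j * xd j) ∧
      xc ∈ polyP A b ∧
      (∀ x ∈ polyP A b, x ≠ xc → ∑ j, c j * x j < ∑ j, c j * xc j) ∧
      ‖xc - xd‖ = ((n : ℝ) - 1) * β * (Δ : ℝ) := by
  obtain ⟨k, rfl⟩ := Nat.exists_eq_add_of_le' hn
  have hΔR : (1 : ℝ) ≤ Δ := by exact_mod_cast hΔ
  have hΔ0 : (0 : ℝ) < Δ := by linarith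
  have hobj : ∀ x : Fin (k + 2) → ℝ, ∑ j, (Pi.single 0 1 : Fin (k + 2) → ℝ) j * x j = x 0 :=
    fun x => by simp [Pi.single_apply]
  refine ⟨k + 2, by lia, tightMatrix (k + 1) Δ, Fin.cons 0 fun _ => β, Pi.single 0 1, 0,
    Fin.cons ((k + 1 : ℕ) * β * Δ) fun _ => β, maxSubdet_tightMatrix k hΔ, ⟨?_, ?_⟩, ?_, ?_, ?_, ?_⟩
  · rw [mem_polyP_tightMatrix]
    simp [hβ0.le]
  · exact fun i => ⟨0, by simp⟩
  · rintro x ⟨hx, hint⟩ hne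
    rw [mem_polyP_tightMatrix] at hx
    have hnonpos : ∀ j : Fin (k + 1), x j.succ ≤ 0 := fun j => by
      obtain ⟨z, hz⟩ := hint j.succ
      have hz1 : (z : ℝ) < 1 := by linarith [hx.2 j]
      have hz0 : z ≤ 0 := Int.lt_add_one_iff.1 (by exact_mod_cast hz1)
      rw [hz]
      exact_mod_cast hz0
    have hzero : (0 : Fin (k + 2) → ℝ) = Fin.cons (((k + 1 : ℕ) : ℝ) * 0 * (Δ : ℝ)) fun _ => 0 := by
      ext i
      cases i using Fin.cases <;> simp
    rw [hobj, hobj]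
    simpa using apply_zero_lt_of_ne hΔ0 hx.1 hnonpos (hzero.symm ▸ hne)
  · rw [mem_polyP_tightMatrix]
    simp [mul_comm]
  · intro x hx hne
    rw [mem_polyP_tightMatrix] at hx
    rw [hobj, hobj]
    exact apply_zero_lt_of_ne hΔ0 hx.1 hx.2 hne
  · have hle : β ≤ (k + 1 : ℕ) * β * Δ := by
      have hk : (1 : ℝ) ≤ (k + 1 : ℕ) := by simp
      nlinarith [one_le_mul_of_one_le_of_one_le hk hΔR]
    rw [sub_zero, norm_cons_const hβ0.le hle]
    push_cast
    ring
end

section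
/- For every integer Δ ≥ 1 and every ε ∈ (0,1), there exist integers n ≥ 5, m ≥ 1, a matrix A ∈ ℤ^{m×n} whose maximum absolute subdeterminant equals Δ, a vector b ∈ ℝ^m, positive reals q_1,…,q_n, and h ∈ ℝⁿ (so k = n) such that, with f(x) = Σ_{i=1}^n (−q_i x_i²) + h·x and P = {x : Ax ≤ b}, both min{f(x) : x ∈ P ∩ ℤⁿ} and min{f(x) : x ∈ P} have optimal solutions, and for every optimal solution x^c of min{f(x) : x ∈ P} and every ε-approximate solution x* of min{f(x) : x ∈ P ∩ ℤⁿ} one has ‖x^c − x*‖_∞ > nΔ. -/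
open scoped BigOperators

namespace ProximityGap

/-- A square matrix each of whose rows is a difference of two coordinate vectors, restricted to
an injective choice of columns, has determinant at most one in absolute value. -/
lemma abs_det_difference_rows_le_one {α : Type*} [DecidableEq α] :
    ∀ (r : ℕ) (p s k : Fin r → α), Function.Injective k →
      |(Matrix.of fun i j => (if p i = k j then (1 : ℤ) else 0) -
        (if s i = k j then 1 else 0)).det| ≤ 1 := by
  intro r
  induction r with
  | zero => intro p s k _; simp
  | succ r ih =>
    intro p s k hk
    by_cases hall : ∀ i, (∃ j, p i = k j) ∧ ∃ j, s i = k j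
    · have hzero : (Matrix.of fun i j => (if p i = k j then (1 : ℤ) else 0) -
          (if s i = k j then 1 else 0)).det = 0 := by
        refine Matrix.exists_mulVec_eq_zero_iff.1 ⟨fun _ => 1, ?_, ?_⟩
        · intro h
          simpa using congrFun h 0
        · funext i
          obtain ⟨⟨j, hj⟩, ⟨l, hl⟩⟩ := hall i
          simp [Matrix.mulVec, dotProduct, hj, hl, hk.eq_iff]
      rw [hzero]
      simp
    · push Not at hall
      obtain ⟨i, hi⟩ := hall
      have hsum : ∀ a : α, ∑ j, |if a = k j then (1 : ℤ) else 0| ≤ 1 := by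
        intro a
        by_cases ha : ∃ j, a = k j
        · obtain ⟨j, rfl⟩ := ha
          simp [hk.eq_iff, apply_ite abs]
        · push Not at ha
          simp [ha]
      have hrow : ∑ j, |(if p i = k j then (1 : ℤ) else 0) - (if s i = k j then 1 else 0)|
          ≤ 1 := by
        by_cases hp : ∃ j, p i = k j
        · have hs := hi hp
          simpa [hs] using hsum (p i)
        · push Not at hp
          simpa [hp] using hsum (s i)
      rw [Matrix.det_succ_row _ i]
      refine (Finset.abs_sum_le_sum_abs _ _).trans (le_trans (Finset.sum_le_sum ?_) hrow)
      intro j _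
      have hminor := ih (p ∘ i.succAbove) (s ∘ i.succAbove) (k ∘ j.succAbove)
        (hk.comp Fin.succAbove_right_injective)
      rw [abs_mul, abs_mul, abs_pow, abs_neg, abs_one, one_pow, one_mul]
      exact mul_le_of_le_one_right (abs_nonneg _) hminor

/-- The coefficients of the five linear forms `x₀`, `x₁ - x₀`, `x₂ - x₁`, `x₃ - x₂`,
`x₄ - Δ x₃`. -/
def chain (Δ : ℤ) : Matrix (Fin 5) (Fin 5) ℤ :=
  !![1, 0, 0, 0, 0; -1, 1, 0, 0, 0; 0, -1, 1, 0, 0; 0, 0, -1, 1, 0; 0, 0, 0, -Δ, 1]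

/-- The constraint matrix bounding every linear form of `chain Δ` from above and from below. -/
def twoSided (Δ : ℤ) : Matrix (Fin (5 + 5)) (Fin 5) ℤ :=
  Matrix.of (Fin.append (chain Δ) (-chain Δ))

lemma twoSided_castAdd (Δ : ℤ) (i j : Fin 5) : twoSided Δ (Fin.castAdd 5 i) j = chain Δ i j :=
  congrFun (Fin.append_left (chain Δ) (-chain Δ) i) j

lemma twoSided_natAdd (Δ : ℤ) (i j : Fin 5) : twoSided Δ (Fin.natAdd 5 i) j = -chain Δ i j :=
  congrFun (Fin.append_right (chain Δ) (-chain Δ) i) j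

lemma abs_det_chain_one_submatrix_le {r : ℕ} (fr fc : Fin r → Fin 5)
    (hfc : Function.Injective fc) : |((chain 1).submatrix fr fc).det| ≤ 1 := by
  have hentry : ∀ i j : Fin 5, chain 1 i j =
      (if i.castSucc = j.castSucc then (1 : ℤ) else 0) -
        (if i.castSucc - 1 = j.castSucc then 1 else 0) := by
    intro i j
    fin_cases i <;> fin_cases j <;> decide
  have h := abs_det_difference_rows_le_one r (fun i => (fr i).castSucc)
    (fun i => (fr i).castSucc - 1) (fun j => (fc j).castSucc)
    ((Fin.castSucc_injective 5).comp hfc)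
  convert h using 3
  ext i j
  exact hentry _ _

lemma abs_det_chain_submatrix_le {Δ : ℤ} (hΔ : 1 ≤ Δ) {r : ℕ} (fr fc : Fin r → Fin 5)
    (hfr : Function.Injective fr) (hfc : Function.Injective fc) :
    |((chain Δ).submatrix fr fc).det| ≤ Δ := by
  set w : Fin 5 → ℤ := ![1, 1, 1, 1, Δ] with hw
  have hw1 : ∀ i, 1 ≤ w i := by
    intro i
    fin_cases i <;> simp [hw, hΔ]
  have hentry : ∀ i j, w j * chain Δ i j = w i * chain 1 i j := by
    intro i j
    fin_cases i <;> fin_cases j <;> simp [hw, chain]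
  have hscale : (∏ j, w (fc j)) * ((chain Δ).submatrix fr fc).det =
      (∏ i, w (fr i)) * ((chain 1).submatrix fr fc).det := by
    rw [← Matrix.det_mul_row, ← Matrix.det_mul_column]
    congr 1
    ext i j
    exact hentry _ _
  have hcols : 1 ≤ ∏ j, w (fc j) := by
    simpa using Finset.prod_le_prod (s := Finset.univ) (f := fun _ => (1 : ℤ))
      (fun j _ => zero_le_one) (fun j _ => hw1 (fc j))
  have hrows : ∏ i, w (fr i) ≤ Δ := by
    calc ∏ i, w (fr i) = ∏ i ∈ Finset.univ.map ⟨fr, hfr⟩, w i := by simp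
      _ ≤ ∏ i, w i := Finset.prod_le_prod_of_subset_of_one_le (Finset.subset_univ _)
          (fun i _ => by linarith [hw1 i]) (fun i _ _ => hw1 i)
      _ = Δ := by simp [hw, Fin.prod_univ_five]
  have hrows0 : 0 ≤ ∏ i, w (fr i) := Finset.prod_nonneg fun i _ => by linarith [hw1 (fr i)]
  calc |((chain Δ).submatrix fr fc).det|
      ≤ (∏ j, w (fc j)) * |((chain Δ).submatrix fr fc).det| :=
        le_mul_of_one_le_left (abs_nonneg _) hcols
    _ = |(∏ j, w (fc j)) * ((chain Δ).submatrix fr fc).det| := by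
        rw [abs_mul, abs_of_nonneg (by linarith : 0 ≤ ∏ j, w (fc j))]
    _ = (∏ i, w (fr i)) * |((chain 1).submatrix fr fc).det| := by
        rw [hscale, abs_mul, abs_of_nonneg hrows0]
    _ ≤ (∏ i, w (fr i)) * 1 :=
        mul_le_mul_of_nonneg_left (abs_det_chain_one_submatrix_le fr fc hfc) hrows0
    _ ≤ Δ := by simpa using hrows

lemma maxSubdet_twoSided {Δ : ℤ} (hΔ : 1 ≤ Δ) : MaxSubdet (twoSided Δ) Δ := by
  constructor
  · intro r fr fc _ _ hfc
    set sgn : Fin (5 + 5) → ℤ := Fin.append (fun _ => 1) (fun _ => -1) with hsgn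
    set row : Fin (5 + 5) → Fin 5 := Fin.append id id with hrow
    have hentry : ∀ i j, twoSided Δ i j = sgn i * chain Δ (row i) j := by
      intro i j
      refine Fin.addCases (fun i => ?_) (fun i => ?_) i
      · simp only [twoSided_castAdd, hsgn, hrow, Fin.append_left, id, one_mul]
      · simp only [twoSided_natAdd, hsgn, hrow, Fin.append_right, id, neg_mul, one_mul]
    have habs : ∀ i, |sgn i| = 1 := by
      intro i
      refine Fin.addCases (fun i => ?_) (fun i => ?_) i
      · simp only [hsgn, Fin.append_left, abs_one]
      · simp only [hsgn, Fin.append_right, abs_neg, abs_one]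
    have hdet : ((twoSided Δ).submatrix fr fc).det =
        (∏ i, sgn (fr i)) * ((chain Δ).submatrix (row ∘ fr) fc).det := by
      rw [← Matrix.det_mul_column]
      congr 1
      ext i j
      exact hentry _ _
    have hprod : |∏ i, sgn (fr i)| = 1 := by
      rw [Finset.abs_prod]
      exact Finset.prod_eq_one fun i _ => habs _
    rw [hdet, abs_mul, hprod, one_mul]
    by_cases hinj : Function.Injective (row ∘ fr)
    · exact abs_det_chain_submatrix_le hΔ _ fc hinj hfc
    · simp only [Function.Injective] at hinj
      push Not at hinj
      obtain ⟨i, j, hij, hne⟩ := hinj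
      rw [Matrix.det_zero_of_row_eq hne (by ext l; exact congrArg (chain Δ · (fc l)) hij)]
      simpa using by linarith
  · refine ⟨1, fun _ => 4, fun _ => 3, one_pos, Function.injective_of_subsingleton _,
      Function.injective_of_subsingleton _, ?_⟩
    have h : twoSided Δ 4 3 = -Δ := rfl
    simp [h, abs_of_nonneg (by linarith : 0 ≤ Δ)]

lemma mem_polyP_twoSided {Δ : ℤ} (l u x : Fin 5 → ℝ) :
    x ∈ polyP (twoSided Δ) (Fin.append u (-l)) ↔
      (l 0 ≤ x 0 ∧ x 0 ≤ u 0) ∧ (l 1 ≤ x 1 - x 0 ∧ x 1 - x 0 ≤ u 1) ∧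
      (l 2 ≤ x 2 - x 1 ∧ x 2 - x 1 ≤ u 2) ∧ (l 3 ≤ x 3 - x 2 ∧ x 3 - x 2 ≤ u 3) ∧
      (l 4 ≤ x 4 - Δ * x 3 ∧ x 4 - Δ * x 3 ≤ u 4) := by
  have hsplit : x ∈ polyP (twoSided Δ) (Fin.append u (-l)) ↔
      ∀ i, (l i ≤ ∑ j, (chain Δ i j : ℝ) * x j) ∧ ∑ j, (chain Δ i j : ℝ) * x j ≤ u i := by
    constructor
    · intro h i
      have h1 := h (Fin.castAdd 5 i)
      have h2 := h (Fin.natAdd 5 i)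
      simp only [twoSided_castAdd, twoSided_natAdd, Fin.append_left, Fin.append_right,
        Pi.neg_apply, Int.cast_neg, neg_mul, Finset.sum_neg_distrib, neg_le_neg_iff] at h1 h2
      exact ⟨h2, h1⟩
    · intro h i
      refine Fin.addCases (fun i => ?_) (fun i => ?_) i
      · simpa only [twoSided_castAdd, Fin.append_left] using (h i).2
      · simpa only [twoSided_natAdd, Fin.append_right, Pi.neg_apply, Int.cast_neg, neg_mul,
          Finset.sum_neg_distrib, neg_le_neg_iff] using (h i).1
  rw [hsplit]
  simp [Fin.forall_fin_succ, Fin.sum_univ_five, chain, neg_add_eq_sub]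

end ProximityGap

open ProximityGap in
/-- **Proposition 2**: for every `Δ ≥ 1` and `ε ∈ (0,1)` there is an (IQP) instance with
subdeterminant `Δ` and `k = n` for which every ε-approximate solution of (IQP) is at
distance greater than `nΔ` from the optimal solution of (QP). -/
theorem stmt12 (Δ : ℤ) (hΔ : 1 ≤ Δ) (ε : ℝ) (hε0 : 0 < ε) (hε1 : ε < 1) :
    ∃ (n m : ℕ), 5 ≤ n ∧ 1 ≤ m ∧
    ∃ (A : Matrix (Fin m) (Fin n) ℤ) (b : Fin m → ℝ) (q h : Fin n → ℝ)
      (f : (Fin n → ℝ) → ℝ),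
      (∀ i, 0 < q i) ∧ MaxSubdet A Δ ∧
      (∀ x, f x = (∑ i, -(q i) * (x i) ^ 2) + ∑ i, h i * x i) ∧
      (∃ xd, IsOptimalSol f (polyP A b ∩ intPts n) xd) ∧
      (∃ xc, IsOptimalSol f (polyP A b) xc) ∧
      (∀ xc, IsOptimalSol f (polyP A b) xc →
        ∀ xd, IsOptimalSol f (polyP A b ∩ intPts n) xd →
        ∀ xstar, IsEpsApprox f (polyP A b ∩ intPts n) xd ε xstar →
          (n : ℝ) * (Δ : ℝ) < ‖xc - xstar‖) := by
  have hD : (1 : ℝ) ≤ Δ := by exact_mod_cast hΔ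
  obtain ⟨β, hβΔ⟩ : ∃ β : ℝ, Δ * β = Δ - 1 / 16 :=
    ⟨(Δ - 1 / 16) / Δ, by field_simp⟩
  have hβ1 : β < 1 := by nlinarith
  have hβ0 : 1 / 2 < β := by nlinarith
  set u : Fin 5 → ℝ := ![β, β, β, β, 1 / 2]
  set l : Fin 5 → ℝ := ![0, 0, 0, -1, 0]
  set f : (Fin 5 → ℝ) → ℝ := fun x => -(x 0 ^ 2 + x 1 ^ 2 + x 2 ^ 2 + x 3 ^ 2 + x 4 ^ 2) with hf
  have hmem : ∀ x : Fin 5 → ℝ, x ∈ polyP (twoSided Δ) (Fin.append u (-l)) ↔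
      (0 ≤ x 0 ∧ x 0 ≤ β) ∧ (0 ≤ x 1 - x 0 ∧ x 1 - x 0 ≤ β) ∧
      (0 ≤ x 2 - x 1 ∧ x 2 - x 1 ≤ β) ∧ (-1 ≤ x 3 - x 2 ∧ x 3 - x 2 ≤ β) ∧
      (0 ≤ x 4 - Δ * x 3 ∧ x 4 - Δ * x 3 ≤ 1 / 2) := fun x => mem_polyP_twoSided l u x
  -- The only integer points are the origin and `(0, 0, 0, -1, -Δ)`.
  have hint : ∀ x ∈ polyP (twoSided Δ) (Fin.append u (-l)) ∩ intPts 5,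
      x 0 = 0 ∧ x 1 = 0 ∧ x 2 = 0 ∧ ((x 3 = 0 ∧ x 4 = 0) ∨ (x 3 = -1 ∧ x 4 = -Δ)) := by
    rintro x ⟨hx, hz⟩
    obtain ⟨⟨h0, h0'⟩, ⟨h1, h1'⟩, ⟨h2, h2'⟩, ⟨h3, h3'⟩, ⟨h4, h4'⟩⟩ := (hmem x).1 hx
    choose z hz using hz
    have step : ∀ t : ℤ, (0 : ℝ) ≤ t → (t : ℝ) < 1 → t = 0 := by
      intro t ht ht'
      have h1 : 0 ≤ t := by exact_mod_cast ht
      have h2 : t < 1 := by exact_mod_cast ht'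
      omega
    simp only [hz] at *
    have e0 : z 0 = 0 := step _ h0 (by linarith)
    simp only [e0, Int.cast_zero, sub_zero] at *
    have e1 : z 1 = 0 := step _ h1 (by linarith)
    simp only [e1, Int.cast_zero, sub_zero] at *
    have e2 : z 2 = 0 := step _ h2 (by linarith)
    simp only [e2, Int.cast_zero, sub_zero] at *
    have e3 : z 3 = 0 ∨ z 3 = -1 := by
      have a : -1 ≤ z 3 := by exact_mod_cast h3
      have b : z 3 < 1 := by exact_mod_cast h3'.trans_lt hβ1
      omega
    have e4 : z 4 - Δ * z 3 = 0 := step _ (by push_cast; linarith) (by push_cast; linarith)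
    refine ⟨trivial, trivial, trivial, ?_⟩
    rcases e3 with e3 | e3
    · left
      rw [e3] at e4 ⊢
      exact ⟨by simp, by exact_mod_cast (by linarith : z 4 = 0)⟩
    · right
      rw [e3] at e4 ⊢
      exact ⟨by simp, by exact_mod_cast (by linarith : z 4 = -Δ)⟩
  have hfar : ![0, 0, 0, -1, -(Δ : ℝ)] ∈ polyP (twoSided Δ) (Fin.append u (-l)) ∩ intPts 5 := by
    refine ⟨(hmem _).2 ?_, fun i => ⟨![0, 0, 0, -1, -Δ] i, ?_⟩⟩
    · simp only [Matrix.cons_val]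
      refine ⟨⟨?_, ?_⟩, ⟨?_, ?_⟩, ⟨?_, ?_⟩, ⟨?_, ?_⟩, ?_, ?_⟩ <;> linarith
    · fin_cases i <;> simp
  have hvertex : ![β, 2 * β, 3 * β, 4 * β, 4 * Δ + 1 / 4] ∈
      polyP (twoSided Δ) (Fin.append u (-l)) := by
    rw [hmem]
    simp only [Matrix.cons_val]
    refine ⟨⟨?_, ?_⟩, ⟨?_, ?_⟩, ⟨?_, ?_⟩, ⟨?_, ?_⟩, ?_, ?_⟩ <;> linarith
  have hbound : ∀ x ∈ polyP (twoSided Δ) (Fin.append u (-l)),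
      x 0 ^ 2 ≤ β ^ 2 ∧ x 1 ^ 2 ≤ (2 * β) ^ 2 ∧ x 2 ^ 2 ≤ (3 * β) ^ 2 ∧
      x 3 ^ 2 ≤ (4 * β) ^ 2 ∧ -(Δ : ℝ) ≤ x 4 ∧ x 4 ≤ 4 * Δ + 1 / 4 := by
    intro x hx
    obtain ⟨⟨h0, h0'⟩, ⟨h1, h1'⟩, ⟨h2, h2'⟩, ⟨h3, h3'⟩, ⟨h4, h4'⟩⟩ := (hmem x).1 hx
    refine ⟨?_, ?_, ?_, ?_, ?_, ?_⟩
    · exact sq_le_sq' (by linarith) (by linarith)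
    · exact sq_le_sq' (by linarith) (by linarith)
    · exact sq_le_sq' (by linarith) (by linarith)
    · exact sq_le_sq' (by linarith) (by linarith)
    · nlinarith
    · nlinarith
  refine ⟨5, 5 + 5, le_rfl, by norm_num, twoSided Δ, Fin.append u (-l), fun _ => 1, fun _ => 0,
    f, fun _ => one_pos, maxSubdet_twoSided hΔ, ?_, ⟨_, hfar, ?_⟩, ⟨_, hvertex, ?_⟩, ?_⟩
  · intro x
    simp [hf, Fin.sum_univ_five]
  · intro x hx
    obtain ⟨e0, e1, e2, ⟨e3, e4⟩ | ⟨e3, e4⟩⟩ := hint x hx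
    · simp only [hf, e0, e1, e2, e3, e4, Matrix.cons_val]
      nlinarith
    · simp [hf, e0, e1, e2, e3, e4]
  · intro x hx
    obtain ⟨h0, h1, h2, h3, h4, h4'⟩ := hbound x hx
    have : x 4 ^ 2 ≤ (4 * Δ + 1 / 4) ^ 2 := sq_le_sq' (by linarith) h4'
    simp only [hf, Matrix.cons_val]
    linarith
  · rintro xc ⟨hxc, hmin⟩ xd ⟨hxd, hdmin⟩ y ⟨hy, happ⟩
    have hxc4 : 4 * (Δ : ℝ) + 1 / 4 ≤ xc 4 := by
      obtain ⟨h0, h1, h2, h3, h4, h4'⟩ := hbound xc hxc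
      have hle := hmin _ hvertex
      simp only [hf, Matrix.cons_val] at hle
      nlinarith
    have hy4 : y 4 = -Δ := by
      obtain ⟨e0, e1, e2, ⟨e3, e4⟩ | ⟨e3, e4⟩⟩ := hint y hy
      · exfalso
        have hfy : f y = 0 := by simp [hf, e0, e1, e2, e3, e4]
        have hfd : f xd < 0 := by
          have := hdmin _ hfar
          simp only [hf, Matrix.cons_val] at this ⊢
          nlinarith
        have hsup : (⨆ z ∈ polyP (twoSided Δ) (Fin.append u (-l)) ∩ intPts 5, (f z : EReal))
            ≤ ((0 : ℝ) : EReal) := by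
          refine iSup₂_le fun z _ => EReal.coe_le_coe_iff.2 ?_
          simp only [hf]
          rw [neg_nonpos]
          positivity
        have hle := happ.trans (mul_le_mul_of_nonneg_left (EReal.sub_le_sub hsup le_rfl)
          (EReal.coe_nonneg.2 hε0.le))
        rw [hfy] at hle
        have hreal : 0 - f xd ≤ ε * (0 - f xd) := by exact_mod_cast hle
        nlinarith
      · exact e4
    have hnorm := norm_le_pi_norm (xc - y) 4
    rw [Pi.sub_apply, Real.norm_eq_abs, hy4] at hnorm
    have := le_abs_self (xc 4 - -(Δ : ℝ))
    push_cast
    linarith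
end

section
/- For every integers n ≥ 2, Δ ≥ 1 and every ε ∈ (0,1], there exist an integer m ≥ 1, a matrix A ∈ ℤ^{m×n} whose maximum absolute subdeterminant equals Δ, a vector b ∈ ℝ^m, positive reals q_1,…,q_n, and h ∈ ℝⁿ (so k = n) such that, with f(x) = Σ_{i=1}^n (−q_i x_i²) + h·x and P = {x : Ax ≤ b}, both min{f(x) : x ∈ P ∩ ℤⁿ} and min{f(x) : x ∈ P} have optimal solutions, and for every optimal solution x^c of min{f(x) : x ∈ P} and every ε-approximate solution x* of min{f(x) : x ∈ P ∩ ℤⁿ} one has ‖x^c − x*‖_∞ ≥ 4(1/ε − 1) + (2/3)(n−1)Δ. -/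
open scoped BigOperators

/-- If every row of `B` other than `i₀` has entries in `{-1, 0, 1}` with at most one nonzero, then
`|det B|` is bounded by any bound `Δ ≥ 0` for the entries of row `i₀`. -/
theorem abs_det_le_of_rows_sparse {Δ : ℤ} (hΔ : 0 ≤ Δ) :
    ∀ {r : ℕ} (B : Matrix (Fin (r + 1)) (Fin (r + 1)) ℤ) (i₀ : Fin (r + 1)),
      (∀ j, |B i₀ j| ≤ Δ) → (∀ i, i ≠ i₀ → ∀ j, |B i j| ≤ 1) →
      (∀ i, i ≠ i₀ → ∀ j j', j ≠ j' → B i j = 0 ∨ B i j' = 0) → |B.det| ≤ Δ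
  | 0, B, i₀, h₀, _, _ => by
    have := h₀ 0
    rw [Fin.fin_one_eq_zero i₀] at this
    simpa [Matrix.det_fin_one] using this
  | r + 1, B, i₀, h₀, h₁, h₂ => by
    obtain ⟨i, hi⟩ := exists_ne i₀
    obtain ⟨k₀, hk₀⟩ := Fin.exists_succAbove_eq hi.symm
    have hminor (j : Fin (r + 2)) : |(B.submatrix i.succAbove j.succAbove).det| ≤ Δ := by
      have hne : ∀ k, k ≠ k₀ → i.succAbove k ≠ i₀ := fun k hk h =>
        hk (Fin.succAbove_right_injective (h.trans hk₀.symm))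
      refine abs_det_le_of_rows_sparse hΔ _ k₀ (fun l => ?_) (fun k hk l => ?_)
        (fun k hk l l' hl => ?_)
      · simpa [hk₀] using h₀ _
      · exact h₁ _ (hne k hk) _
      · exact h₂ _ (hne k hk) _ _ (fun h => hl (Fin.succAbove_right_injective h))
    rw [Matrix.det_succ_row B i]
    by_cases hz : ∃ j, B i j ≠ 0
    · obtain ⟨j, hj⟩ := hz
      rw [Finset.sum_eq_single j]
      · rw [abs_mul, abs_mul, abs_pow, abs_neg, abs_one, one_pow, one_mul]
        exact (mul_le_mul (h₁ i hi j) (hminor j) (abs_nonneg _) zero_le_one).trans_eq (one_mul Δ)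
      · intro j' _ hj'
        have : B i j' = 0 := (h₂ i hi j' j hj').resolve_right hj
        simp [this]
      · simp
    · push Not at hz
      simpa [hz] using hΔ

/-- The constraint matrix of the system `-x i ≤ 0` for all `i`, `x 0 - Δ * ∑ i, x (i + 1) ≤ β`,
and `x (i + 1) ≤ γ` for all `i`. -/
def proximityMatrix (k : ℕ) (Δ : ℤ) : Matrix (Fin ((k + 2) + (k + 2))) (Fin (k + 2)) ℤ :=
  fun i j => Fin.addCases (fun i => if i = j then -1 else 0)
    (fun i => if i = 0 then (if j = 0 then 1 else -Δ) else if i = j then 1 else 0) i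

/-- The right-hand side of the system with matrix `proximityMatrix`. -/
def proximityVector (k : ℕ) (β γ : ℝ) : Fin ((k + 2) + (k + 2)) → ℝ :=
  Fin.addCases (fun _ => 0) (fun i => if i = 0 then β else γ)

theorem mem_polyP_proximityMatrix {k : ℕ} {Δ : ℤ} {β γ : ℝ} {x : Fin (k + 2) → ℝ} :
    x ∈ polyP (proximityMatrix k Δ) (proximityVector k β γ) ↔
      (∀ i, 0 ≤ x i) ∧ x 0 ≤ β + Δ * ∑ i : Fin (k + 1), x i.succ ∧
        ∀ i : Fin (k + 1), x i.succ ≤ γ := by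
  have hdense : ∑ j, (((if j = 0 then 1 else -Δ : ℤ)) : ℝ) * x j
      = x 0 - Δ * ∑ i : Fin (k + 1), x i.succ := by
    rw [Fin.sum_univ_succ, Finset.mul_sum]
    simp [Fin.succ_ne_zero, sub_eq_add_neg]
  have hlow (i : Fin (k + 2)) : ∑ j, (((if i = j then -1 else 0 : ℤ)) : ℝ) * x j = - x i := by
    simp
  have hupp (i : Fin (k + 2)) : ∑ j, (((if i = j then 1 else 0 : ℤ)) : ℝ) * x j = x i := by
    simp
  rw [polyP, Set.mem_ofPred_eq, Fin.forall_fin_add]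
  simp only [proximityMatrix, proximityVector, Fin.addCases_left, Fin.addCases_right, hlow,
    Left.neg_nonpos_iff]
  refine and_congr_right fun _ => ?_
  rw [Fin.forall_fin_succ]
  simp only [if_true, hdense, Fin.succ_ne_zero, if_false, hupp, sub_le_iff_le_add]

theorem maxSubdet_proximityMatrix (k : ℕ) {Δ : ℤ} (hΔ : 1 ≤ Δ) :
    MaxSubdet (proximityMatrix k Δ) Δ := by
  set d : Fin ((k + 2) + (k + 2)) := Fin.natAdd (k + 2) 0 with hd
  have hdrow (j) : proximityMatrix k Δ d j = if j = 0 then 1 else -Δ := by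
    simp only [proximityMatrix, hd, Fin.addCases_right, if_true]
  have hle : ∀ i, i ≠ d → ∀ j, |proximityMatrix k Δ i j| ≤ 1 := by
    intro i
    induction i using Fin.addCases with
    | left i =>
      intro _ j
      simp only [proximityMatrix, Fin.addCases_left]
      split_ifs <;> simp
    | right i =>
      intro hi j
      have hi0 : i ≠ 0 := fun h => hi (by rw [h])
      simp only [proximityMatrix, Fin.addCases_right, hi0, if_false]
      split_ifs <;> simp
  have hsparse : ∀ i, i ≠ d → ∀ j j', j ≠ j' →
      proximityMatrix k Δ i j = 0 ∨ proximityMatrix k Δ i j' = 0 := by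
    intro i
    induction i using Fin.addCases with
    | left i =>
      intro _ j j' hj
      simp only [proximityMatrix, Fin.addCases_left]
      grind
    | right i =>
      intro hi j j' hj
      have hi0 : i ≠ 0 := fun h => hi (by rw [h])
      simp only [proximityMatrix, Fin.addCases_right, hi0, if_false]
      grind
  have hleΔ (i j) : |proximityMatrix k Δ i j| ≤ Δ := by
    by_cases hi : i = d
    · rw [hi, hdrow]
      split_ifs
      · simpa using hΔ
      · rw [abs_neg, abs_of_nonneg (by lia)]
    · exact (hle i hi j).trans hΔ
  refine ⟨fun r fr fc hr hfr hfc => ?_, 1, ![d], ![1], one_pos,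
    Function.injective_of_subsingleton _, Function.injective_of_subsingleton _, ?_⟩
  · obtain ⟨r, rfl⟩ := Nat.exists_eq_succ_of_ne_zero hr.ne'
    obtain ⟨i₀, hi₀⟩ : ∃ i₀, ∀ i, i ≠ i₀ → fr i ≠ d := by
      by_cases h : ∃ i₀, fr i₀ = d
      · obtain ⟨i₀, h⟩ := h
        exact ⟨i₀, fun i hi h' => hi (hfr (h'.trans h.symm))⟩
      · push Not at h
        exact ⟨0, fun i _ => h i⟩
    exact abs_det_le_of_rows_sparse (by lia) _ i₀ (fun j => hleΔ _ _)
      (fun i hi j => hle _ (hi₀ i hi) _)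
      (fun i hi j j' hj => hsparse _ (hi₀ i hi) _ _ (fun h => hj (hfc h)))
  · rw [Matrix.det_fin_one]
    simp [hdrow, abs_of_nonneg (show (0 : ℤ) ≤ Δ by lia)]

/-- An integer `M` close to `4 / ε` such that `x ↦ x * (M + 1 - x)` takes at the integers
`1, …, M` only values above the fraction `ε` of its maximum. -/
theorem exists_nat_mul_sq_lt {ε : ℝ} (hε0 : 0 < ε) (hε1 : ε ≤ 1) :
    ∃ M : ℕ, 4 * (1 / ε - 1) ≤ M ∧ (1 ≤ M → ε * ((M + 1) ^ 2 / 4) < (M : ℝ)) := by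
  have hnn : 0 ≤ 4 * (1 / ε - 1) := by
    have := (one_le_div hε0).2 hε1
    linarith
  refine ⟨⌈4 * (1 / ε - 1)⌉₊, Nat.le_ceil _, fun hM => ?_⟩
  set M := ⌈4 * (1 / ε - 1)⌉₊
  have hlt : (M : ℝ) < 4 * (1 / ε - 1) + 1 := Nat.ceil_lt_add_one hnn
  have hge : 4 * (1 / ε - 1) ≤ M := Nat.le_ceil _
  have hpos : 0 < 4 * (1 / ε - 1) := Nat.ceil_pos.1 hM
  have h1 : ε * (1 / ε) = 1 := by field_simp
  have hεlt : ε < 1 := by nlinarith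
  have hlt' : ε * (M + 3) < 4 := by nlinarith
  rcases hM.eq_or_lt with h | h
  · rw [← h]
    norm_num
    linarith
  · have h2 : (2 : ℝ) ≤ M := by exact_mod_cast h
    nlinarith

theorem IsEpsApprox.le_of_forall_le {α : Type*} {f : α → ℝ} {S : Set α} {xopt x : α} {ε C : ℝ}
    (hx : IsEpsApprox f S xopt ε x) (hε : 0 ≤ ε) (hC : ∀ y ∈ S, f y ≤ C) :
    f x - f xopt ≤ ε * (C - f xopt) := by
  have hsup : (⨆ y ∈ S, (f y : EReal)) ≤ C :=
    iSup₂_le fun y hy => EReal.coe_le_coe_iff.2 (hC y hy)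
  have h := hx.2.trans (mul_le_mul_of_nonneg_left (EReal.sub_le_sub hsup le_rfl)
    (EReal.coe_nonneg.2 hε))
  exact_mod_cast h

/-- **Proposition 3**: for all `n ≥ 2`, `Δ ≥ 1`, `ε ∈ (0,1]` there is an (IQP) instance
with subdeterminant `Δ` and `k = n` for which every ε-approximate solution of (IQP) is at
distance at least `4(1/ε − 1) + (2/3)(n−1)Δ` from every optimal solution of (QP). -/
theorem stmt13 (n : ℕ) (hn : 2 ≤ n) (Δ : ℤ) (hΔ : 1 ≤ Δ)
    (ε : ℝ) (hε0 : 0 < ε) (hε1 : ε ≤ 1) :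
    ∃ (m : ℕ), 1 ≤ m ∧
    ∃ (A : Matrix (Fin m) (Fin n) ℤ) (b : Fin m → ℝ) (q h : Fin n → ℝ)
      (f : (Fin n → ℝ) → ℝ),
      (∀ i, 0 < q i) ∧ MaxSubdet A Δ ∧
      (∀ x, f x = (∑ i, -(q i) * (x i) ^ 2) + ∑ i, h i * x i) ∧
      (∃ xd, IsOptimalSol f (polyP A b ∩ intPts n) xd) ∧
      (∃ xc, IsOptimalSol f (polyP A b) xc) ∧
      (∀ xc, IsOptimalSol f (polyP A b) xc →
        ∀ xd, IsOptimalSol f (polyP A b ∩ intPts n) xd →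
        ∀ xstar, IsEpsApprox f (polyP A b ∩ intPts n) xd ε xstar →
          4 * (1 / ε - 1) + (2 / 3) * ((n : ℝ) - 1) * (Δ : ℝ) ≤ ‖xc - xstar‖) := by
  obtain ⟨k, rfl⟩ := Nat.exists_eq_add_of_le' hn
  obtain ⟨M, hM, hMε⟩ := exists_nat_mul_sq_lt hε0 hε1
  have hΔ' : (1 : ℝ) ≤ Δ := by exact_mod_cast hΔ
  set h : Fin (k + 2) → ℝ := fun i => if i = 0 then (M : ℝ) + 1 else 0 with hh
  set f : (Fin (k + 2) → ℝ) → ℝ :=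
    fun x => (∑ i, -(1 : ℝ) * (x i) ^ 2) + ∑ i, h i * x i with hf
  have hfx (x) : f x = x 0 * (M + 1 - x 0) - ∑ i : Fin (k + 1), x i.succ ^ 2 := by
    simp only [hf, hh, Fin.sum_univ_succ (n := k + 1), if_true, Fin.succ_ne_zero, if_false,
      zero_mul, Finset.sum_const_zero, neg_mul, one_mul, Finset.sum_neg_distrib]
    ring
  set P := polyP (proximityMatrix k Δ) (proximityVector k (M + 2 / 3) (2 / 3))
  set T : ℝ := 2 / 3 * (k + 1) * Δ with hT
  have hT' : 2 / 3 ≤ T := by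
    have : (0 : ℝ) ≤ k := k.cast_nonneg
    nlinarith [mul_nonneg this (zero_le_one.trans hΔ')]
  -- a minimizer over `P`; `hgap` shows that all minimizers share its first coordinate
  set p : Fin (k + 2) → ℝ := Fin.cons (M + 2 / 3 + T) fun _ => 2 / 3 with hp
  have hp0 : p 0 = M + 2 / 3 + T := rfl
  have hps (i : Fin (k + 1)) : p i.succ = 2 / 3 := rfl
  have hpP : p ∈ P := by
    refine mem_polyP_proximityMatrix.2 ⟨?_, ?_, fun i => (hps i).le⟩
    · refine Fin.forall_fin_succ.2 ⟨?_, fun i => ?_⟩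
      · rw [hp0]; positivity
      · rw [hps]; norm_num
    · simp only [hp0, hps, Finset.sum_const, Finset.card_univ, Fintype.card_fin, nsmul_eq_mul, hT]
      push_cast
      linarith
  have hx0 : ∀ x ∈ P, x 0 ≤ p 0 := by
    intro x hx
    obtain ⟨-, h2, h3⟩ := mem_polyP_proximityMatrix.1 hx
    have : ∑ i : Fin (k + 1), x i.succ ≤ 2 / 3 * (k + 1) := by
      refine (Finset.sum_le_sum fun i _ => h3 i).trans_eq ?_
      simp only [Finset.sum_const, Finset.card_univ, Fintype.card_fin, nsmul_eq_mul]
      push_cast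
      ring
    rw [hp0, hT]
    nlinarith
  have hgap : ∀ x ∈ P, (p 0 - x 0) / 3 ≤ f x - f p := by
    intro x hx
    obtain ⟨h1, -, h3⟩ := mem_polyP_proximityMatrix.1 hx
    have hsq : ∑ i : Fin (k + 1), x i.succ ^ 2 ≤ ∑ i : Fin (k + 1), p i.succ ^ 2 :=
      Finset.sum_le_sum fun i _ => pow_le_pow_left₀ (h1 _) (h3 i) 2
    have hle := hx0 x hx
    have := h1 0
    rw [hfx, hfx]
    have : 0 ≤ (p 0 - x 0) * (x 0 + (p 0 - M - 1) - 1 / 3) :=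
      mul_nonneg (by linarith) (by rw [hp0]; linarith)
    linarith
  have hint : ∀ x ∈ P ∩ intPts (k + 2), f x = x 0 * (M + 1 - x 0) ∧
      (x 0 = 0 ∨ 1 ≤ x 0 ∧ x 0 ≤ M) := by
    rintro x ⟨hx, hxZ⟩
    obtain ⟨h1, h2, h3⟩ := mem_polyP_proximityMatrix.1 hx
    have hzero (i : Fin (k + 1)) : x i.succ = 0 := by
      obtain ⟨z, hz⟩ := hxZ i.succ
      have ha := h1 i.succ
      have hb := h3 i
      rw [hz] at ha hb ⊢
      have hb' : (z : ℝ) < 1 := by linarith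
      have : 0 ≤ z := by exact_mod_cast ha
      have : z < 1 := by exact_mod_cast hb'
      exact_mod_cast (show z = 0 by lia)
    refine ⟨by simp [hfx, hzero], ?_⟩
    obtain ⟨z, hz⟩ := hxZ 0
    have ha := h1 0
    simp only [hzero, Finset.sum_const_zero, mul_zero, add_zero] at h2
    rw [hz] at ha h2 ⊢
    have hb : (z : ℝ) < (M : ℤ) + 1 := by push_cast; linarith
    have hz0 : 0 ≤ z := by exact_mod_cast ha
    have hzM : z < M + 1 := by exact_mod_cast hb
    rcases hz0.eq_or_lt with hz0 | hz0
    · exact .inl (by exact_mod_cast hz0.symm)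
    · exact .inr ⟨by exact_mod_cast hz0, by exact_mod_cast Int.lt_add_one_iff.1 hzM⟩
  have hint_nonneg : ∀ x ∈ P ∩ intPts (k + 2), 0 ≤ f x := by
    intro x hx
    obtain ⟨hfx, h0 | h0⟩ := hint x hx
    · simp [hfx, h0]
    · rw [hfx]
      exact mul_nonneg (by linarith) (by linarith)
  have h0mem : (0 : Fin (k + 2) → ℝ) ∈ P ∩ intPts (k + 2) := by
    refine ⟨mem_polyP_proximityMatrix.2 ⟨by simp, ?_, ?_⟩, fun i => ⟨0, by simp⟩⟩
    · simp only [Pi.zero_apply, Finset.sum_const_zero, mul_zero, add_zero]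
      positivity
    · intro i
      norm_num
  have hf0 : f 0 = 0 := by simp [hfx]
  refine ⟨(k + 2) + (k + 2), by lia, proximityMatrix k Δ, proximityVector k (M + 2 / 3) (2 / 3),
    fun _ => 1, h, f, fun _ => one_pos, maxSubdet_proximityMatrix k hΔ, fun _ => rfl,
    ⟨0, h0mem, fun y hy => hf0.trans_le (hint_nonneg y hy)⟩,
    ⟨p, hpP, fun y hy => by linarith [hgap y hy, hx0 y hy]⟩, ?_⟩
  intro xc hxc xd hxd xs hxs
  have hc : p 0 ≤ xc 0 := by linarith [hgap xc hxc.1, hxc.2 p hpP]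
  have hd : f xd = 0 := le_antisymm (hf0 ▸ hxd.2 0 h0mem) (hint_nonneg xd hxd.1)
  have happ := hxs.le_of_forall_le hε0.le (C := ((M : ℝ) + 1) ^ 2 / 4) fun y hy => by
    rw [(hint y hy).1]
    nlinarith [sq_nonneg (2 * y 0 - (M + 1))]
  rw [hd, sub_zero, sub_zero] at happ
  have hs : xs 0 = 0 := by
    obtain ⟨hfs, h0 | ⟨h0, h0'⟩⟩ := hint xs hxs.1
    · exact h0
    · have : ε * (((M : ℝ) + 1) ^ 2 / 4) < M := hMε (by exact_mod_cast h0.trans h0')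
      nlinarith
  have hnorm : xc 0 ≤ ‖xc - xs‖ := by
    have := (le_abs_self _).trans (norm_le_pi_norm (xc - xs) 0)
    simpa [hs] using this
  push_cast
  rw [hp0] at hc
  have : 2 / 3 * ((k : ℝ) + 2 - 1) * Δ = T := by rw [hT]; ring
  linarith
end

section
/- For every integers n ≥ 2, Δ ≥ 2 and every ε ∈ (0, 1/2), there exist an integer m ≥ 1, a matrix A ∈ ℤ^{m×n} whose maximum absolute subdeterminant equals Δ, a vector b ∈ ℝ^m, a positive real q_1, and h ∈ ℝⁿ (so k = 1) such that, with f(x) = −q_1 x_1² + h·x and P = {x : Ax ≤ b}, both min{f(x) : x ∈ P ∩ ℤⁿ} and min{f(x) : x ∈ P} have optimal solutions, and for every optimal solution x^d of min{f(x) : x ∈ P ∩ ℤⁿ} and every ε-approximate solution x^⋆ of min{f(x) : x ∈ P} one has ‖x^⋆ − x^d‖_∞ ≥ ((n−1)Δ − 1)/ε − 2. -/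
open scoped BigOperators

/-- The constraint matrix of the system `-x₀ + Δ ∑ j, xⱼ₊₁ ≤ β`, `x₀ ≤ B`, `-xⱼ₊₁ ≤ -δ`. -/
def wedgeMatrix (k : ℕ) (Δ : ℤ) : Matrix (Fin (k + 2)) (Fin (k + 1)) ℤ :=
  Matrix.of (Fin.cons (Fin.cons (-1) fun _ => Δ)
    (Matrix.diagonal (Fin.cons 1 fun _ => -1) : Matrix (Fin (k + 1)) (Fin (k + 1)) ℤ))

/-- The right-hand side of the system with matrix `wedgeMatrix`. -/
def wedgeRhs (k : ℕ) (β B δ : ℝ) : Fin (k + 2) → ℝ :=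
  Fin.cons β (Fin.cons B fun _ => -δ)

lemma wedgeMatrix_zero_zero (k : ℕ) (Δ : ℤ) : wedgeMatrix k Δ 0 0 = -1 := rfl

lemma wedgeMatrix_zero_succ {k : ℕ} (Δ : ℤ) (j : Fin k) : wedgeMatrix k Δ 0 j.succ = Δ := rfl

lemma wedgeMatrix_succ {k : ℕ} (Δ : ℤ) (i j : Fin (k + 1)) :
    wedgeMatrix k Δ i.succ j =
      if i = j then (Fin.cons 1 fun _ => -1 : Fin (k + 1) → ℤ) i else 0 := rfl

lemma mem_polyP_wedge {k : ℕ} {Δ : ℤ} {β B δ : ℝ} {x : Fin (k + 1) → ℝ} :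
    x ∈ polyP (wedgeMatrix k Δ) (wedgeRhs k β B δ) ↔
      -x 0 + Δ * ∑ j : Fin k, x j.succ ≤ β ∧ x 0 ≤ B ∧ ∀ j : Fin k, δ ≤ x j.succ := by
  simp only [polyP, Set.mem_ofPred_eq]
  rw [Fin.forall_fin_succ, Fin.forall_fin_succ]
  simp only [wedgeRhs, Fin.sum_univ_succ, wedgeMatrix_zero_zero, wedgeMatrix_zero_succ,
    wedgeMatrix_succ, Finset.mul_sum, Fin.cons_zero, Fin.cons_succ, Fin.succ_inj,
    Fin.succ_ne_zero, (Fin.succ_ne_zero _).symm]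
  simp

lemma abs_det_submatrix_wedgeMatrix_le {k : ℕ} {Δ : ℤ} (hΔ : 1 ≤ Δ) (r : ℕ)
    (fr : Fin r → Fin (k + 2)) (fc : Fin r → Fin (k + 1))
    (hfr : Function.Injective fr) (hfc : Function.Injective fc) :
    |((wedgeMatrix k Δ).submatrix fr fc).det| ≤ Δ := by
  induction r with
  | zero => simpa using hΔ
  | succ r ih =>
    by_cases hrow : ∃ i, fr i ≠ 0
    · obtain ⟨i, hi⟩ := hrow
      obtain ⟨l, hl⟩ := Fin.exists_succ_eq.2 hi
      have hentry : ∀ j, (wedgeMatrix k Δ).submatrix fr fc i j =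
          if l = fc j then (Fin.cons 1 fun _ => -1 : Fin (k + 1) → ℤ) l else 0 := by
        intro j
        rw [Matrix.submatrix_apply, ← hl, wedgeMatrix_succ]
      have hsign : |(Fin.cons 1 fun _ => -1 : Fin (k + 1) → ℤ) l| = 1 := by
        refine Fin.cases ?_ (fun _ => ?_) l <;> simp
      rw [Matrix.det_succ_row _ i]
      by_cases hcol : ∃ j, l = fc j
      · obtain ⟨j, hj⟩ := hcol
        rw [Finset.sum_eq_single j]
        · rw [hentry, if_pos hj, abs_mul, abs_mul, abs_pow, abs_neg, abs_one, one_pow, hsign,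
            one_mul, one_mul, Matrix.submatrix_submatrix]
          exact ih _ _ (hfr.comp Fin.succAbove_right_injective)
            (hfc.comp Fin.succAbove_right_injective)
        · intro j' _ hj'
          have : l ≠ fc j' := fun h => hj' (hfc (h.symm.trans hj))
          rw [hentry, if_neg this, mul_zero, zero_mul]
        · simp
      · push Not at hcol
        rw [Finset.sum_eq_zero]
        · simpa using zero_le_one.trans hΔ
        · intro j _
          rw [hentry, if_neg (hcol j), mul_zero, zero_mul]
    · push Not at hrow
      obtain rfl : r = 0 := by
        by_contra hr
        have := hfr ((hrow 0).trans (hrow (Fin.last r)).symm)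
        exact hr (by simpa using (congrArg Fin.val this).symm)
      rw [Matrix.det_fin_one, Matrix.submatrix_apply, hrow]
      refine Fin.cases ?_ (fun j => ?_) (fc 0)
      · simpa [wedgeMatrix_zero_zero] using hΔ
      · simp [wedgeMatrix_zero_succ, abs_of_nonneg (zero_le_one.trans hΔ)]

lemma maxSubdet_wedgeMatrix {k : ℕ} (hk : 1 ≤ k) {Δ : ℤ} (hΔ : 1 ≤ Δ) :
    MaxSubdet (wedgeMatrix k Δ) Δ := by
  refine ⟨fun r fr fc _ hfr hfc => abs_det_submatrix_wedgeMatrix_le hΔ r fr fc hfr hfc,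
    1, fun _ => 0, fun _ => Fin.succ ⟨0, hk⟩, one_pos, Function.injective_of_subsingleton _,
    Function.injective_of_subsingleton _, ?_⟩
  rw [Matrix.det_fin_one, Matrix.submatrix_apply, wedgeMatrix_zero_succ,
    abs_of_nonneg (zero_le_one.trans hΔ)]

lemma IsEpsApprox.sub_le_of_le {α : Type*} {f : α → ℝ} {S : Set α} {xopt x : α} {ε M : ℝ}
    (h : IsEpsApprox f S xopt ε x) (hε : 0 ≤ ε) (hM : ∀ y ∈ S, f y ≤ M) :
    f x - f xopt ≤ ε * (M - f xopt) := by
  have hsup : (⨆ y ∈ S, (f y : EReal)) ≤ (M : EReal) :=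
    iSup₂_le fun y hy => EReal.coe_le_coe_iff.2 (hM y hy)
  have := h.2.trans (mul_le_mul_of_nonneg_left (EReal.sub_le_sub hsup le_rfl)
    (EReal.coe_nonneg.2 hε))
  exact_mod_cast this

/-- Parameters of the instance: `a` is the depth of the wedge, `η` its total shift. -/
lemma exists_wedge_parameters {N ε : ℝ} (hN : 2 ≤ N) (hε0 : 0 < ε) (hε1 : ε < 1 / 2) :
    ∃ (a η : ℝ) (B : ℤ), 0 < a ∧ 0 < η ∧ η ≤ 1 ∧ 1 ≤ B ∧ (B : ℝ) ≤ (1 - ε) * a ∧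
      N ≤ a + η ∧ a + η - N < B ∧ (N - 1) / ε - 2 ≤ B + (1 - ε) * a := by
  have hη : 0 < ε * (1 - 2 * ε) := mul_pos hε0 (by linarith)
  have hηε : ε * (1 - 2 * ε) ≤ ε := by nlinarith
  obtain ⟨a, ha⟩ : ∃ a, a = (N - ε * (1 - 2 * ε) - 1) / ε := ⟨_, rfl⟩
  have haε : ε * a = N - ε * (1 - 2 * ε) - 1 := by rw [ha]; field_simp
  have ha0 : 0 < a := ha ▸ div_pos (by linarith) hε0
  have hw : 1 ≤ (1 - ε) * a := by
    have h1 : 1 - ε * (1 - 2 * ε) ≤ ε * a := by linarith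
    have h2 : (1 - ε) * (1 - ε * (1 - 2 * ε)) ≤ (1 - ε) * (ε * a) :=
      mul_le_mul_of_nonneg_left h1 (by linarith)
    have h3 : 0 ≤ (1 - 2 * ε) * (1 - ε + ε ^ 2) :=
      mul_nonneg (by linarith) (by nlinarith)
    refine le_of_mul_le_mul_left ?_ hε0
    nlinarith
  have hlt := Int.lt_floor_add_one ((1 - ε) * a)
  refine ⟨a, ε * (1 - 2 * ε), ⌊(1 - ε) * a⌋, ha0, hη, by linarith,
    Int.le_floor.2 (by simpa using hw),
    Int.floor_le _, by linarith, by linarith, ?_⟩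
  have hdiv : (N - 1) / ε = a + (1 - 2 * ε) := by rw [ha]; field_simp; ring
  nlinarith

/-- **Proposition 4**: for all `n ≥ 2`, `Δ ≥ 2`, `ε ∈ (0, 1/2)` there is an (IQP)
instance with subdeterminant `Δ` and `k = 1` for which every ε-approximate solution of
(QP) is at distance at least `((n−1)Δ − 1)/ε − 2` from every optimal solution of (IQP). -/
theorem stmt14 (n : ℕ) (hn : 2 ≤ n) (Δ : ℤ) (hΔ : 2 ≤ Δ)
    (ε : ℝ) (hε0 : 0 < ε) (hε1 : ε < 1 / 2) :
    ∃ (m : ℕ), 1 ≤ m ∧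
    ∃ (A : Matrix (Fin m) (Fin n) ℤ) (b : Fin m → ℝ) (q1 : ℝ) (h : Fin n → ℝ)
      (f : (Fin n → ℝ) → ℝ),
      0 < q1 ∧ MaxSubdet A Δ ∧
      (∀ x, f x = -q1 * (x ⟨0, by omega⟩) ^ 2 + ∑ i, h i * x i) ∧
      (∃ xd, IsOptimalSol f (polyP A b ∩ intPts n) xd) ∧
      (∃ xc, IsOptimalSol f (polyP A b) xc) ∧
      (∀ xd, IsOptimalSol f (polyP A b ∩ intPts n) xd →
        ∀ xc, IsOptimalSol f (polyP A b) xc →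
        ∀ xstar, IsEpsApprox f (polyP A b) xc ε xstar →
          (((n : ℝ) - 1) * (Δ : ℝ) - 1) / ε - 2 ≤ ‖xstar - xd‖) := by
  obtain ⟨k, rfl⟩ : ∃ k, n = k + 1 := ⟨n - 1, by omega⟩
  have hk : 1 ≤ k := by omega
  have hk' : (1 : ℝ) ≤ k := by exact_mod_cast hk
  have hΔ' : (2 : ℝ) ≤ Δ := by exact_mod_cast hΔ
  have hN : (2 : ℝ) ≤ k * Δ := by nlinarith
  obtain ⟨a, η, B, ha0, hη0, hη1, hB1, hBa, haN, haB, hdist⟩ := exists_wedge_parameters hN hε0 hε1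
  have hB1' : (1 : ℝ) ≤ B := by exact_mod_cast hB1
  have hkΔ : (0 : ℝ) < k * Δ := by linarith
  have hδ0 : 0 < η / (k * Δ) := div_pos hη0 hkΔ
  have hδ1 : η / (k * Δ) ≤ 1 := (div_le_one hkΔ).2 (by linarith)
  have hδ : Δ * (k * (η / (k * Δ))) = η := by
    rw [← mul_assoc, mul_comm (Δ : ℝ), mul_div_cancel₀ _ hkΔ.ne']
  set P := polyP (wedgeMatrix k Δ) (wedgeRhs k (a + η) B (η / (k * Δ)))
  set f : (Fin (k + 1) → ℝ) → ℝ := fun x => -(x 0) ^ 2 with hf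
  have hxcP : (Fin.cons (-a) fun _ => η / (k * Δ) : Fin (k + 1) → ℝ) ∈ P := by
    refine mem_polyP_wedge.2 ⟨?_, ?_, ?_⟩
    · simp [hδ]
    · simpa using by linarith
    · simp
  have hxdP : (Fin.cons (B : ℝ) fun _ => 1 : Fin (k + 1) → ℝ) ∈ P ∩ intPts (k + 1) := by
    refine ⟨mem_polyP_wedge.2 ⟨?_, ?_, ?_⟩, fun i => ?_⟩
    · simp only [Fin.cons_zero, Fin.cons_succ, Finset.sum_const, Finset.card_univ,
        Fintype.card_fin, nsmul_eq_mul, mul_one]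
      linarith
    · simp
    · simpa using fun _ => hδ1
    · refine Fin.cases ⟨B, by simp⟩ (fun _ => ⟨1, by simp⟩) i
  have hP_lower : ∀ x ∈ P, -a ≤ x 0 := by
    intro x hx
    obtain ⟨h1, -, h3⟩ := mem_polyP_wedge.1 hx
    have hsum : k * (η / (k * Δ)) ≤ ∑ j : Fin k, x j.succ := by
      simpa using Finset.card_nsmul_le_sum Finset.univ (fun j : Fin k => x j.succ) _
        fun j _ => h3 j
    have := mul_le_mul_of_nonneg_left hsum (show (0 : ℝ) ≤ Δ by linarith)
    linarith
  have hInt_lower : ∀ x ∈ P ∩ intPts (k + 1), -(B : ℝ) < x 0 := by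
    rintro x ⟨hx, hxint⟩
    obtain ⟨h1, -, h3⟩ := mem_polyP_wedge.1 hx
    have hone : ∀ j : Fin k, 1 ≤ x j.succ := by
      intro j
      obtain ⟨z, hz⟩ := hxint j.succ
      have hpos := hδ0.trans_le (h3 j)
      rw [hz] at hpos ⊢
      exact_mod_cast Int.add_one_le_iff.2 (Int.cast_pos.1 hpos)
    have hsum : (k : ℝ) ≤ ∑ j : Fin k, x j.succ := by
      simpa using Finset.card_nsmul_le_sum Finset.univ (fun j : Fin k => x j.succ) _
        fun j _ => hone j
    have := mul_le_mul_of_nonneg_left hsum (show (0 : ℝ) ≤ Δ by linarith)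
    linarith
  have hupper : ∀ x ∈ P, x 0 ≤ B := fun x hx => (mem_polyP_wedge.1 hx).2.1
  refine ⟨k + 2, by omega, wedgeMatrix k Δ, wedgeRhs k (a + η) B (η / (k * Δ)), 1, 0, f, one_pos,
    maxSubdet_wedgeMatrix hk (by omega), fun x => by simp [hf], ⟨_, hxdP, fun y hy => ?_⟩,
    ⟨_, hxcP, fun y hy => ?_⟩, fun xd hxd xc hxc xstar hstar => ?_⟩
  · have := hInt_lower y hy
    have := hupper y hy.1
    simp only [hf, Fin.cons_zero]
    nlinarith
  · have := hP_lower y hy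
    have := hupper y hy
    have : (1 - ε) * a ≤ a := mul_le_of_le_one_left ha0.le (by linarith)
    simp only [hf, Fin.cons_zero]
    nlinarith
  · have hxd0 : xd 0 = B := by
      have h1 := hxd.2 _ hxdP
      have h2 := hInt_lower xd hxd.1
      have h3 := hupper xd hxd.1.1
      simp only [hf, Fin.cons_zero] at h1
      nlinarith
    have hgap := hstar.sub_le_of_le hε0.le (M := 0) fun y _ => by
      simp only [hf]; nlinarith [sq_nonneg (y 0)]
    have hxc := hxc.2 _ hxcP
    simp only [hf, Fin.cons_zero] at hgap hxc
    have hstar_upper := hupper xstar hstar.1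
    have hsq : ((1 - ε) * a) ^ 2 < xstar 0 ^ 2 := by
      have h1 : (1 - ε) * a ^ 2 ≤ (1 - ε) * xc 0 ^ 2 :=
        mul_le_mul_of_nonneg_left (by linarith) (by linarith)
      have h2 : 0 < ε * (1 - ε) * a ^ 2 :=
        mul_pos (mul_pos hε0 (by linarith)) (pow_pos ha0 2)
      nlinarith
    have hstar_lt : xstar 0 < -((1 - ε) * a) := by
      rcases lt_abs.1 (lt_of_pow_lt_pow_left₀ 2 (abs_nonneg _) (hsq.trans_eq (sq_abs _).symm))
        with h | h <;> linarith
    have hnorm := norm_le_pi_norm (xstar - xd) 0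
    rw [Pi.sub_apply, hxd0, Real.norm_eq_abs] at hnorm
    have := neg_le_abs (xstar 0 - B)
    push_cast
    rw [add_sub_cancel_right]
    linarith
end

section
/- Let 1 ≤ k ≤ n, let q_1,…,q_k be positive reals, and let x^l, x^r ∈ ℝⁿ. Define q(x) := Σ_{i=1}^k (−q_i x_i²), the affine function λ(x) := Σ_{i=1}^k −q_i·((x^l_i + x^r_i)·x_i − x^l_i·x^r_i), and the box D := Π_{i=1}^n [min{x^l_i, x^r_i}, max{x^l_i, x^r_i}]. Then for every x ∈ D one has λ(x) ≤ q(x) ≤ λ(x) + (1/4)·Σ_{i=1}^k q_i·(x^l_i − x^r_i)². -/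
open scoped BigOperators

/-- A point between `a` and `b` satisfies `(t - a) * (t - b) ≤ 0`. -/
theorem sub_mul_sub_nonpos_of_mem_uIcc {a b t : ℝ} (h : min a b ≤ t ∧ t ≤ max a b) :
    (t - a) * (t - b) ≤ 0 := by
  rcases le_total a b with hab | hab
  · rw [min_eq_left hab, max_eq_right hab] at h
    exact mul_nonpos_of_nonneg_of_nonpos (sub_nonneg.2 h.1) (sub_nonpos.2 h.2)
  · rw [min_eq_right hab, max_eq_left hab] at h
    exact mul_nonpos_of_nonpos_of_nonneg (sub_nonpos.2 h.2) (sub_nonneg.2 h.1)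

/-- **Claim 7**: on the box `D` spanned by `x^l` and `x^r`, the affine interpolant `λ`
of the separable concave quadratic `q` satisfies
`λ(x) ≤ q(x) ≤ λ(x) + (1/4) Σᵢ qᵢ (x^l_i − x^r_i)²`. -/
theorem stmt15 {n k : ℕ} (hk : 1 ≤ k) (hkn : k ≤ n)
    (q : Fin k → ℝ) (hq : ∀ i, 0 < q i)
    (xl xr : Fin n → ℝ) (x : Fin n → ℝ)
    (hx : ∀ i, min (xl i) (xr i) ≤ x i ∧ x i ≤ max (xl i) (xr i)) :
    (∑ i : Fin k, -(q i) *
        ((xl (Fin.castLE hkn i) + xr (Fin.castLE hkn i)) * x (Fin.castLE hkn i) -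
          xl (Fin.castLE hkn i) * xr (Fin.castLE hkn i)))
      ≤ ∑ i : Fin k, -(q i) * (x (Fin.castLE hkn i)) ^ 2 ∧
    (∑ i : Fin k, -(q i) * (x (Fin.castLE hkn i)) ^ 2)
      ≤ (∑ i : Fin k, -(q i) *
          ((xl (Fin.castLE hkn i) + xr (Fin.castLE hkn i)) * x (Fin.castLE hkn i) -
            xl (Fin.castLE hkn i) * xr (Fin.castLE hkn i)))
        + (1 / 4) * ∑ i : Fin k, q i * (xl (Fin.castLE hkn i) - xr (Fin.castLE hkn i)) ^ 2 := by
  constructor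
  · refine Finset.sum_le_sum fun i _ => ?_
    have h := mul_nonpos_of_nonneg_of_nonpos (hq i).le
      (sub_mul_sub_nonpos_of_mem_uIcc (hx (Fin.castLE hkn i)))
    linarith
  · rw [Finset.mul_sum, ← Finset.sum_add_distrib]
    refine Finset.sum_le_sum fun i _ => ?_
    have h := mul_nonneg (hq i).le (sq_nonneg
      (x (Fin.castLE hkn i) - (xl (Fin.castLE hkn i) + xr (Fin.castLE hkn i)) / 2))
    linarith
end

section
/- For every integer t ≥ 0, consider minimizing g(x) := −(x − 1/4)² over the set {x ∈ ℤ : −t ≤ x ≤ t + 3/4}. The unique minimizer is x = −t. Moreover, the unique minimizer of g over {x ∈ ℝ : −t ≤ x ≤ t + 3/4} is x = t + 3/4, so the distance between the two minimizers is 2t + 3/4, which is unbounded as t → ∞ while the instance has dimension one and all constraint coefficients equal to ±1. -/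
/-- **Example 1**: minimizing `g(x) = −(x − 1/4)²` over `{x ∈ ℤ : −t ≤ x ≤ t + 3/4}`
has unique minimizer `−t`, while over `{x ∈ ℝ : −t ≤ x ≤ t + 3/4}` the unique minimizer
is `t + 3/4`; the distance between the two minimizers is `2t + 3/4`. -/
theorem stmt17 (t : ℤ) (ht : 0 ≤ t) (g : ℝ → ℝ) (hg : ∀ x, g x = -(x - 1 / 4) ^ 2) :
    ((-(t : ℝ)) ∈ {x : ℝ | (∃ z : ℤ, x = (z : ℝ)) ∧ -(t : ℝ) ≤ x ∧ x ≤ (t : ℝ) + 3 / 4} ∧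
      ∀ x ∈ {x : ℝ | (∃ z : ℤ, x = (z : ℝ)) ∧ -(t : ℝ) ≤ x ∧ x ≤ (t : ℝ) + 3 / 4},
        x ≠ -(t : ℝ) → g (-(t : ℝ)) < g x) ∧
    (((t : ℝ) + 3 / 4) ∈ {x : ℝ | -(t : ℝ) ≤ x ∧ x ≤ (t : ℝ) + 3 / 4} ∧
      ∀ x ∈ {x : ℝ | -(t : ℝ) ≤ x ∧ x ≤ (t : ℝ) + 3 / 4},
        x ≠ (t : ℝ) + 3 / 4 → g ((t : ℝ) + 3 / 4) < g x) ∧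
    |((t : ℝ) + 3 / 4) - (-(t : ℝ))| = 2 * (t : ℝ) + 3 / 4 := by
  have ht' : (0 : ℝ) ≤ t := by exact_mod_cast ht
  refine ⟨⟨⟨⟨-t, by push_cast; rfl⟩, le_rfl, by linarith⟩, ?_⟩,
    ⟨⟨by linarith, le_rfl⟩, ?_⟩, ?_⟩
  · rintro x ⟨⟨z, rfl⟩, hlo, hhi⟩ hne
    have hzt : z < t + 1 := by
      have : (z : ℝ) < t + 1 := by linarith
      exact_mod_cast this
    have hz : (z : ℝ) ≤ t := by exact_mod_cast Int.lt_add_one_iff.mp hzt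
    have hlt : -(t : ℝ) < z := lt_of_le_of_ne hlo hne.symm
    have hprod : 0 < ((t : ℝ) + z) * (t + 1 / 2 - z) :=
      mul_pos (by linarith) (by linarith)
    rw [hg, hg]
    linarith
  · rintro x ⟨hlo, hhi⟩ hne
    have hlt : x < t + 3 / 4 := lt_of_le_of_ne hhi hne
    have hprod : 0 < ((t : ℝ) + 3 / 4 - x) * (t + 1 / 4 + x) :=
      mul_pos (by linarith) (by linarith)
    rw [hg, hg]
    linarith
  · rw [abs_of_nonneg (by linarith)]
    ring
end
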